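/- If positive linear bounded maps Φ : 𝔗(ℋ) → 𝔗(ℋ') and Ψ : 𝔗(ℋ') → 𝔗(ℋ'') each have output entropy continuous on the set of rank-≤1 positive trace-class operators (equivalently, each is a PCE-map), then the composition Ψ∘Φ : 𝔗(ℋ) → 𝔗(ℋ'') also has this property; in particular, the composition of two PCE-maps is a PCE-map. -/

import Mathlib

open scoped ENNReal NNReal
open Filter Topology Classical
attribute [local instance] Classical.propDecidable

noncomputable section

namespace QIT

section Defs

variable {E F G : Type*}
variable [NormedAddCommGroup E] [InnerProductSpace ℂ E] [CompleteSpace E]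
variable [NormedAddCommGroup F] [InnerProductSpace ℂ F] [CompleteSpace F]
variable [NormedAddCommGroup G] [InnerProductSpace ℂ G] [CompleteSpace G]

/-- The real part of `⟪x, A x⟫`. -/
def qf (A : E →L[ℂ] E) (x : E) : ℝ := (inner ℂ x (A x) : ℂ).re

/-- The trace of a positive operator, as the supremum of finite diagonal sums over
finite orthonormal families.  For positive operators this coincides with the usual
trace (with value `∞` when the operator is not trace class). -/
def traceENN (A : E →L[ℂ] E) : ℝ≥0∞ :=
  ⨆ (n : ℕ) (e : Fin n → E) (_ : Orthonormal ℂ e), ∑ i, ENNReal.ofReal (qf A (e i))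

/-- The trace norm `‖A‖₁`, as the supremum of `∑ |⟪e i, A (f i)⟫|` over pairs of finite
orthonormal families; it is finite exactly on trace-class operators. -/
def traceNorm (A : E →L[ℂ] E) : ℝ≥0∞ :=
  ⨆ (n : ℕ) (e : Fin n → E) (f : Fin n → E) (_ : Orthonormal ℂ e) (_ : Orthonormal ℂ f),
    ∑ i, ENNReal.ofReal ‖(inner ℂ (e i) (A (f i)) : ℂ)‖

/-- `A` is a trace-class operator. -/
def IsTC (A : E →L[ℂ] E) : Prop := traceNorm A ≠ ∞

/-- The cone `𝔗₊(E)` of positive trace-class operators. -/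
def posTC (E : Type*) [NormedAddCommGroup E] [InnerProductSpace ℂ E] [CompleteSpace E] :
    Set (E →L[ℂ] E) := {A | A.IsPositive ∧ IsTC A}

/-- The set `𝔖(E)` of states (density operators). -/
def states (E : Type*) [NormedAddCommGroup E] [InnerProductSpace ℂ E] [CompleteSpace E] :
    Set (E →L[ℂ] E) := {A | A.IsPositive ∧ traceENN A = 1}

/-- The extended classical entropy `H({x_i}) = ∑ η(x_i) − η(∑ x_i)` of a nonnegative
summable family, written in the equivalent homogeneous form `(∑ x) · H({x_i/∑x})`. -/
def clEntropy {ι : Type*} (x : ι → ℝ) : ℝ≥0∞ :=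
  ENNReal.ofReal (∑' i, x i) *
    ∑' i, ENNReal.ofReal (Real.negMulLog (x i / (∑' j, x j)))

/-- An orthonormal subset with dense span (an orthonormal basis, as a set). -/
def IsONB (s : Set E) : Prop :=
  Orthonormal ℂ ((↑) : s → E) ∧ Dense ((Submodule.span ℂ s : Submodule ℂ E) : Set E)

/-- The quantum (von Neumann) entropy `H(A) = Tr η(A) − η(Tr A)` of a positive trace-class
operator, realized as the infimum over all orthonormal bases of the classical entropy of
the diagonal of `A` (the infimum is attained on an eigenbasis of `A`). -/
def qEntropy (A : E →L[ℂ] E) : ℝ≥0∞ :=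
  ⨅ (s : Set E) (_ : IsONB s), clEntropy fun v : s => qf A v

theorem exists_isONB (E : Type*) [NormedAddCommGroup E] [InnerProductSpace ℂ E]
    [CompleteSpace E] : ∃ s : Set E, IsONB s := by
  obtain ⟨w, b, hb⟩ := exists_hilbertBasis ℂ E
  refine ⟨w, ?_, ?_⟩
  · have h := b.orthonormal
    rwa [hb] at h
  · have h := b.dense_span
    rw [hb, Subtype.range_coe] at h
    rwa [Submodule.dense_iff_topologicalClosure_eq_top]

/-- A fixed orthonormal basis (as a set). -/
def stdONB (E : Type*) [NormedAddCommGroup E] [InnerProductSpace ℂ E] [CompleteSpace E] :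
    Set E := (exists_isONB E).choose

/-- The `ℂ`-valued trace, computed in a fixed orthonormal basis; for trace-class
operators it does not depend on the choice of the basis. -/
def traceC (A : E →L[ℂ] E) : ℂ := ∑' v : stdONB E, (inner ℂ (v : E) (A v) : ℂ)

/-- Continuity (including finiteness) of an `ℝ≥0∞`-valued function on a subset of
operators, with respect to the trace-norm distance. -/
def ContOn (f : (E →L[ℂ] E) → ℝ≥0∞) (𝒜 : Set (E →L[ℂ] E)) : Prop :=
  (∀ A ∈ 𝒜, f A ≠ ∞) ∧
  ∀ A ∈ 𝒜, ∀ ε : ℝ, 0 < ε → ∃ δ : ℝ, 0 < δ ∧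
    ∀ B ∈ 𝒜, traceNorm (B - A) < ENNReal.ofReal δ → |(f B).toReal - (f A).toReal| < ε

/-- Continuity of a real-valued function on a subset of operators with respect to the
trace-norm distance. -/
def RContOn (g : (E →L[ℂ] E) → ℝ) (𝒜 : Set (E →L[ℂ] E)) : Prop :=
  ∀ A ∈ 𝒜, ∀ ε : ℝ, 0 < ε → ∃ δ : ℝ, 0 < δ ∧
    ∀ B ∈ 𝒜, traceNorm (B - A) < ENNReal.ofReal δ → |g B - g A| < ε

/-- Boundedness of an `ℝ≥0∞`-valued function on a set. -/
def BddOn (f : (E →L[ℂ] E) → ℝ≥0∞) (𝒜 : Set (E →L[ℂ] E)) : Prop :=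
  ∃ C : ℝ, ∀ A ∈ 𝒜, f A ≤ ENNReal.ofReal C

/-- Convergence of a sequence of operators in the trace norm. -/
def TendstoTN (A : ℕ → (E →L[ℂ] E)) (A₀ : E →L[ℂ] E) : Prop :=
  ∀ ε : ℝ, 0 < ε → ∃ N : ℕ, ∀ n ≥ N, traceNorm (A n - A₀) < ENNReal.ofReal ε

/-- A positive linear map from the trace class of `E` to the trace class of `F`
(the values of `toFun` outside the trace class are irrelevant). -/
structure TraceMap (E F : Type*) [NormedAddCommGroup E] [InnerProductSpace ℂ E]
    [CompleteSpace E] [NormedAddCommGroup F] [InnerProductSpace ℂ F] [CompleteSpace F] where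
  toFun : (E →L[ℂ] E) → (F →L[ℂ] F)
  map_add : ∀ A B, IsTC A → IsTC B → toFun (A + B) = toFun A + toFun B
  map_smul : ∀ (c : ℂ) A, IsTC A → toFun (c • A) = c • toFun A
  maps_tc : ∀ A, IsTC A → IsTC (toFun A)
  pos : ∀ A, IsTC A → A.IsPositive → (toFun A).IsPositive

/-- A trace-non-increasing map. -/
def TraceMap.TNI (Φ : TraceMap E F) : Prop :=
  ∀ A, IsTC A → A.IsPositive → traceENN (Φ.toFun A) ≤ traceENN A

/-- A trace-preserving map. -/
def TraceMap.TP (Φ : TraceMap E F) : Prop :=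
  ∀ A, IsTC A → A.IsPositive → traceENN (Φ.toFun A) = traceENN A

/-- A map bounded with respect to the trace norm. -/
def TraceMap.Bounded (Φ : TraceMap E F) : Prop :=
  ∃ C : ℝ≥0, ∀ A, traceNorm (Φ.toFun A) ≤ (C : ℝ≥0∞) * traceNorm A

/-- The output entropy `H_Φ = H ∘ Φ`. -/
def outEntropy (Φ : TraceMap E F) (A : E →L[ℂ] E) : ℝ≥0∞ := qEntropy (Φ.toFun A)

/-- The rank-one operator `|x⟩⟨x|`. -/
def rankOne (x : E) : E →L[ℂ] E := (innerSL ℂ x).smulRight x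

/-- The rank-one operator `|x⟩⟨y|`. -/
def rankOneM (x y : E) : E →L[ℂ] E := (innerSL ℂ y).smulRight x

end Defs

section Defs2

variable {E F G : Type*}
variable [NormedAddCommGroup E] [InnerProductSpace ℂ E] [CompleteSpace E]
variable [NormedAddCommGroup F] [InnerProductSpace ℂ F] [CompleteSpace F]
variable [NormedAddCommGroup G] [InnerProductSpace ℂ G] [CompleteSpace G]

/-- The completely positive map `A ↦ ∑ᵢ Vᵢ A Vᵢ*` defined by a sequence of Kraus
operators. -/
def krausMap (V : ℕ → (E →L[ℂ] F)) (A : E →L[ℂ] E) : F →L[ℂ] F :=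
  ∑' i, V i ∘L A ∘L ContinuousLinearMap.adjoint (V i)

/-- The Kraus condition `∑ᵢ Vᵢ* Vᵢ ≤ I` (all partial sums are dominated by `I`). -/
def KrausTNI (V : ℕ → (E →L[ℂ] F)) : Prop :=
  ∀ n : ℕ,
    ((1 : E →L[ℂ] E) - ∑ i ∈ Finset.range n, ContinuousLinearMap.adjoint (V i) ∘L V i).IsPositive

/-- The Kraus condition `∑ᵢ Vᵢ* Vᵢ = I` (strong convergence), i.e. trace preservation. -/
def KrausTP (V : ℕ → (E →L[ℂ] F)) : Prop :=
  ∀ x : E, HasSum (fun i => (ContinuousLinearMap.adjoint (V i)) (V i x)) x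

/-- `(Φ, Φt)` is a complementary pair of quantum operations: for some Kraus
representation `Φ(·) = ∑ᵢ Vᵢ (·) Vᵢ*` and some orthonormal basis `{bᵢ}` of `G`,
`Φt(A) = ∑_{i,j} Tr[Vᵢ A Vⱼ*] |bᵢ⟩⟨bⱼ|` (characterized by its matrix entries). -/
def IsComplementaryPair (Φ : TraceMap E F) (Φt : TraceMap E G) : Prop :=
  ∃ (V : ℕ → (E →L[ℂ] F)) (b : HilbertBasis ℕ ℂ G),
    KrausTNI V ∧
    (∀ A, IsTC A → Φ.toFun A = krausMap V A) ∧
    (∀ A, IsTC A → ∀ i j : ℕ,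
      (inner ℂ (b i) (Φt.toFun A (b j)) : ℂ) =
        traceC (V i ∘L A ∘L ContinuousLinearMap.adjoint (V j)))

/-- A map (on trace-class operators) preserves continuity of the entropy:
its output entropy is continuous on every subset of the positive trace-class cone on
which the von Neumann entropy is continuous. -/
def PCE (Φf : (E →L[ℂ] E) → (F →L[ℂ] F)) : Prop :=
  ∀ 𝒜 : Set (E →L[ℂ] E), 𝒜 ⊆ posTC E → ContOn qEntropy 𝒜 →
    ContOn (fun A => qEntropy (Φf A)) 𝒜

/-- `μ` is the sequence of nonzero eigenvalues (with multiplicities, possibly padded by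
zeros) of the diagonalizable positive operator `T`, every vector orthogonal to the
eigenvectors being annihilated by `T`. -/
def IsEigenSeq (T : E →L[ℂ] E) (μ : ℕ → ℝ) : Prop :=
  ∃ e : ℕ → E,
    (∀ i j, i ≠ j → (inner ℂ (e i) (e j) : ℂ) = 0) ∧
    (∀ i, (μ i ≠ 0 → ‖e i‖ = 1) ∧ (μ i = 0 → e i = 0)) ∧
    (∀ i, T (e i) = (μ i : ℂ) • e i) ∧
    (∀ x : E, (∀ i, (inner ℂ (e i) x : ℂ) = 0) → T x = 0)

/-- `ν` is the sequence of singular values of `V` (eigenvalues of `√(V*V)`,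
equivalently `ν²` are the eigenvalues of `V*V`). -/
def IsSingularValues (V : E →L[ℂ] F) (ν : ℕ → ℝ) : Prop :=
  (∀ i, 0 ≤ ν i) ∧ IsEigenSeq (ContinuousLinearMap.adjoint V ∘L V) (fun i => ν i ^ 2)

/-- `∑ᵢ e^{−l/νᵢ²}`, the sum being taken over the indices with `νᵢ ≠ 0`. -/
def expSum (ν : ℕ → ℝ) (l : ℝ) : ℝ≥0∞ :=
  ∑' i, if ν i = 0 then 0 else ENNReal.ofReal (Real.exp (-(l / ν i ^ 2)))

/-- `λ*(V) < ∞`: `V` is compact (automatic here) and `∑ᵢ e^{−l/νᵢ²} < ∞` for some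
`l > 0`, where `{νᵢ}` are the singular values of `V`. -/
def LamStarFin (V : E →L[ℂ] F) : Prop :=
  ∃ ν : ℕ → ℝ, IsSingularValues V ν ∧ ∃ l : ℝ, 0 < l ∧ expSum ν l ≠ ∞

/-- `λ*(√S) < ∞` for a positive operator `S` (the singular values of `√S` are the
square roots of the eigenvalues of `S`). -/
def LamStarSqrtFin (S : E →L[ℂ] E) : Prop :=
  ∃ ν : ℕ → ℝ, (∀ i, 0 ≤ ν i) ∧ IsEigenSeq S (fun i => ν i ^ 2) ∧
    ∃ l : ℝ, 0 < l ∧ expSum ν l ≠ ∞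

/-- The value `λ*` associated to a sequence `ν` of singular values: the unique solution
of `∑ᵢ e^{−λ/νᵢ²} = 1` if it exists, and `inf{λ > 0 | ∑ᵢ e^{−λ/νᵢ²} < ∞}` otherwise. -/
def lamStarOf (ν : ℕ → ℝ) : ℝ≥0∞ :=
  if h : ∃ l : ℝ, expSum ν l = 1 then ENNReal.ofReal h.choose
  else ⨅ (l : ℝ) (_ : 0 < l ∧ expSum ν l ≠ ∞), ENNReal.ofReal l

/-- The parameter `λ*(V) ∈ [0,∞]` of a bounded operator `V`. -/
def lamStar (V : E →L[ℂ] F) : ℝ≥0∞ :=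
  if h : ∃ ν : ℕ → ℝ, IsSingularValues V ν then lamStarOf h.choose else ∞

/-- `rank A ≤ k`. -/
def rankLE (A : E →L[ℂ] E) (k : ℕ) : Prop :=
  Module.rank ℂ (LinearMap.range (A : E →ₗ[ℂ] E)) ≤ k

/-- The set `𝔗₊ᵏ(E)` of positive (trace-class) operators of rank at most `k`. -/
def rankCone (E : Type*) [NormedAddCommGroup E] [InnerProductSpace ℂ E] [CompleteSpace E]
    (k : ℕ) : Set (E →L[ℂ] E) := {A | A.IsPositive ∧ rankLE A k}

/-- A decomposition of `A` into a countable convex combination of positive operators of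
rank at most `k`. -/
structure Decomp (k : ℕ) (A : E →L[ℂ] E) where
  π : ℕ → ℝ
  op : ℕ → (E →L[ℂ] E)
  π_nonneg : ∀ i, 0 ≤ π i
  π_sum : HasSum π 1
  op_pos : ∀ i, (op i).IsPositive
  op_rank : ∀ i, rankLE (op i) k
  sum_eq : HasSum (fun i => π i • op i) A

/-- The `k`-order approximator `H_Φᵏ` of the output entropy of `Φ`. -/
def kApprox (Φf : (E →L[ℂ] E) → (F →L[ℂ] F)) (k : ℕ) (A : E →L[ℂ] E) : ℝ≥0∞ :=
  ⨆ d : Decomp k A, ∑' i, ENNReal.ofReal (d.π i) * qEntropy (Φf (d.op i))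

/-- The set of pure states (extreme points of `𝔖(E)`). -/
def pureStates (E : Type*) [NormedAddCommGroup E] [InnerProductSpace ℂ E]
    [CompleteSpace E] : Set (E →L[ℂ] E) := {A | ∃ x : E, ‖x‖ = 1 ∧ A = rankOne x}

end Defs2

section Tensor

variable (E F G : Type*)
variable [NormedAddCommGroup E] [InnerProductSpace ℂ E] [CompleteSpace E]
variable [NormedAddCommGroup F] [InnerProductSpace ℂ F] [CompleteSpace F]
variable [NormedAddCommGroup G] [InnerProductSpace ℂ G] [CompleteSpace G]

/-- A realization of `G` as the Hilbert tensor product `E ⊗ F`, together with the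
tensor product of (bounded) operators. -/
structure TensorData where
  tmul : E → F → G
  add_left : ∀ x y z, tmul (x + y) z = tmul x z + tmul y z
  add_right : ∀ x y z, tmul x (y + z) = tmul x y + tmul x z
  smul_left : ∀ (c : ℂ) x y, tmul (c • x) y = c • tmul x y
  smul_right : ∀ (c : ℂ) x y, tmul x (c • y) = c • tmul x y
  inner_tmul : ∀ x x' y y',
    (inner ℂ (tmul x y) (tmul x' y') : ℂ) = (inner ℂ x x' : ℂ) * (inner ℂ y y' : ℂ)
  dense_span : Dense ((Submodule.span ℂ {z | ∃ x y, z = tmul x y} : Submodule ℂ G) : Set G)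
  omul : (E →L[ℂ] E) → (F →L[ℂ] F) → (G →L[ℂ] G)
  omul_tmul : ∀ A B x y, omul A B (tmul x y) = tmul (A x) (B y)

end Tensor

set_option linter.unusedSectionVars false

section Classical

variable {ι κ : Type*}

/-- The contribution `T · η(x / T)` of a weight `x` to the entropy of a family of total mass `T`. -/
def entTerm (x T : ℝ) : ℝ := T * Real.negMulLog (x / T)

theorem entTerm_zero_left (T : ℝ) : entTerm 0 T = 0 := by simp [entTerm]

theorem entTerm_nonneg {x T : ℝ} (hx : 0 ≤ x) (hT : x ≤ T) : 0 ≤ entTerm x T :=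
  mul_nonneg (hx.trans hT) (Real.negMulLog_nonneg (div_nonneg hx (hx.trans hT))
    (div_le_one_of_le₀ hT (hx.trans hT)))

theorem entTerm_eq {x T : ℝ} (hT : 0 < T) :
    entTerm x T = x * (Real.log T - Real.log x) := by
  rcases eq_or_ne x 0 with rfl | hx
  · simp [entTerm]
  · rw [entTerm, Real.negMulLog, Real.log_div hx hT.ne']
    field_simp
    ring

theorem entTerm_add_le {a b S T : ℝ} (ha : 0 ≤ a) (haS : a ≤ S) (hb : 0 ≤ b) (hbT : b ≤ T) :
    entTerm a S + entTerm b T ≤ entTerm (a + b) (S + T) := by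
  rcases (ha.trans haS).eq_or_lt with hS | hS
  · obtain rfl : a = 0 := le_antisymm (haS.trans hS.ge) ha
    simp [← hS, entTerm_zero_left]
  rcases (hb.trans hbT).eq_or_lt with hT | hT
  · obtain rfl : b = 0 := le_antisymm (hbT.trans hT.ge) hb
    simp [← hT, entTerm_zero_left]
  have hST : 0 < S + T := add_pos hS hT
  have h := Real.concaveOn_negMulLog.2 (x := a / S) (y := b / T)
    (div_nonneg ha hS.le) (div_nonneg hb hT.le)
    (div_nonneg hS.le hST.le) (div_nonneg hT.le hST.le) (by field_simp)
  simp only [smul_eq_mul] at h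
  have e : S / (S + T) * (a / S) + T / (S + T) * (b / T) = (a + b) / (S + T) := by
    field_simp
  rw [e] at h
  have h2 := mul_le_mul_of_nonneg_left h hST.le
  calc entTerm a S + entTerm b T
      = (S + T) * (S / (S + T) * Real.negMulLog (a / S)
          + T / (S + T) * Real.negMulLog (b / T)) := by
        rw [entTerm, entTerm]; field_simp
    _ ≤ entTerm (a + b) (S + T) := h2

theorem entTerm_mono_right {x S T : ℝ} (hx : 0 ≤ x) (hS : x ≤ S) (hT : S ≤ T) :
    entTerm x S ≤ entTerm x T := by
  have h := entTerm_add_le hx hS le_rfl (sub_nonneg.2 hT)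
  simpa [entTerm_zero_left] using h

theorem clEntropy_eq {x : ι → ℝ} (hx : ∀ i, 0 ≤ x i) :
    clEntropy x = ∑' i, ENNReal.ofReal (entTerm (x i) (∑' j, x j)) := by
  rw [clEntropy, ← ENNReal.tsum_mul_left]
  refine tsum_congr fun i => ?_
  rw [← ENNReal.ofReal_mul (tsum_nonneg hx), entTerm]

theorem clEntropy_add_le {a b : ι → ℝ} (ha : ∀ i, 0 ≤ a i) (hb : ∀ i, 0 ≤ b i)
    (hsa : Summable a) (hsb : Summable b) :
    clEntropy a + clEntropy b ≤ clEntropy (fun i => a i + b i) := by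
  rw [clEntropy_eq ha, clEntropy_eq hb, clEntropy_eq fun i => add_nonneg (ha i) (hb i),
    ← ENNReal.tsum_add, hsa.tsum_add hsb]
  refine ENNReal.tsum_le_tsum fun i => ?_
  have h1 := hsa.le_tsum i fun j _ => ha j
  have h2 := hsb.le_tsum i fun j _ => hb j
  rw [← ENNReal.ofReal_add (entTerm_nonneg (ha i) h1) (entTerm_nonneg (hb i) h2)]
  exact ENNReal.ofReal_le_ofReal (entTerm_add_le (ha i) h1 (hb i) h2)

theorem clEntropy_mono {a b : ι → ℝ} (ha : ∀ i, 0 ≤ a i) (hab : ∀ i, a i ≤ b i)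
    (hsb : Summable b) : clEntropy a ≤ clEntropy b := by
  have hsa : Summable a := hsb.of_nonneg_of_le ha hab
  have h := clEntropy_add_le ha (fun i => sub_nonneg.2 (hab i)) hsa (hsb.sub hsa)
  simp only [add_sub_cancel] at h
  exact le_self_add.trans h

theorem clEntropy_const_mul (x : ι → ℝ) {c : ℝ} (hc : 0 ≤ c) :
    clEntropy (fun i => c * x i) = ENNReal.ofReal c * clEntropy x := by
  rcases hc.eq_or_lt with rfl | hc'
  · simp [clEntropy]
  · simp only [clEntropy, tsum_mul_left, mul_div_mul_left _ _ hc'.ne', ENNReal.ofReal_mul hc,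
      mul_assoc]

theorem clEntropy_sigma {β : ι → Type*} {x : (Σ i, β i) → ℝ} (hx : ∀ p, 0 ≤ x p)
    (hs : Summable x) :
    clEntropy x = (∑' i, clEntropy fun j => x ⟨i, j⟩) + clEntropy fun i => ∑' j, x ⟨i, j⟩ := by
  have hi : ∀ i, Summable fun j => x ⟨i, j⟩ := hs.sigma_factor
  have hni : ∀ i, 0 ≤ ∑' j, x ⟨i, j⟩ := fun i => tsum_nonneg fun j => hx _
  rw [clEntropy_eq hx, clEntropy_eq hni, ENNReal.tsum_sigma', ← ENNReal.tsum_add,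
    ← hs.tsum_sigma]
  refine tsum_congr fun i => ?_
  rw [clEntropy_eq fun j => hx _]
  set T := ∑' p, x p
  set Ti := ∑' j, x ⟨i, j⟩ with hTi
  have hTiT : Ti ≤ T := by
    rw [show T = ∑' i, ∑' j, x ⟨i, j⟩ from hs.tsum_sigma]
    exact hs.sigma.le_tsum i fun j _ => hni j
  have hle : ∀ j, x ⟨i, j⟩ ≤ Ti := fun j => (hi i).le_tsum j fun k _ => hx _
  rcases (hni i).eq_or_lt with h0 | h0
  · have hz : ∀ j, x ⟨i, j⟩ = 0 := fun j => le_antisymm ((hle j).trans h0.ge) (hx _)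
    have : Ti = 0 := h0.symm
    simp [hz, this, entTerm_zero_left]
  have hT : 0 < T := h0.trans_le hTiT
  have hL : 0 ≤ Real.log T - Real.log Ti := sub_nonneg.2 (Real.log_le_log h0 hTiT)
  rw [entTerm_eq hT, ENNReal.ofReal_mul h0.le, hTi,
    ENNReal.ofReal_tsum_of_nonneg (fun j => hx _) (hi i), ← ENNReal.tsum_mul_right,
    ← ENNReal.tsum_add]
  refine tsum_congr fun j => ?_
  rw [← ENNReal.ofReal_mul (hx _), ← ENNReal.ofReal_add (entTerm_nonneg (hx _) (hle j))
    (mul_nonneg (hx _) hL), entTerm_eq hT, entTerm_eq h0]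
  congr 1
  ring

theorem clEntropy_unique [Unique ι] (x : ι → ℝ) : clEntropy x = 0 := by
  rw [clEntropy, tsum_fintype, tsum_fintype, Fintype.sum_unique, Fintype.sum_unique]
  rcases eq_or_ne (x default) 0 with h | h
  · simp [h]
  · simp [div_self h]

theorem clEntropy_fintype [Fintype ι] {x : ι → ℝ} (hx : ∀ i, 0 ≤ x i) :
    clEntropy x =
      ENNReal.ofReal ((∑ i, Real.negMulLog (x i)) - Real.negMulLog (∑ i, x i)) := by
  rw [clEntropy_eq hx, tsum_fintype, tsum_fintype, ← ENNReal.ofReal_sum_of_nonneg fun i _ =>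
    entTerm_nonneg (hx i) (Finset.single_le_sum (fun j _ => hx j) (Finset.mem_univ i))]
  congr 1
  rcases (Finset.sum_nonneg fun i (_ : i ∈ Finset.univ) => hx i).eq_or_lt with h | h
  · have hz : ∀ i, x i = 0 := fun i =>
      (Finset.sum_eq_zero_iff_of_nonneg fun i _ => hx i).1 h.symm i (Finset.mem_univ i)
    simp [hz, entTerm]
  · simp only [entTerm_eq h, mul_sub, Finset.sum_sub_distrib, ← Finset.sum_mul, Real.negMulLog,
      neg_mul, Finset.sum_neg_distrib]
    ring

theorem clEntropy_compl_tendsto {x : ι → ℝ} (hx : ∀ i, 0 ≤ x i) (hs : Summable x)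
    (hfin : clEntropy x ≠ ∞) :
    Tendsto (fun J : Finset ι => clEntropy fun i : {i // i ∉ J} => x i) atTop (𝓝 0) := by
  rw [clEntropy_eq hx] at hfin
  refine tendsto_of_tendsto_of_tendsto_of_le_of_le tendsto_const_nhds
    (ENNReal.tendsto_tsum_compl_atTop_zero hfin) (fun _ => zero_le) fun J => ?_
  show clEntropy (fun i : {i // i ∉ J} => x i) ≤ _
  rw [clEntropy_eq fun i => hx _]
  refine ENNReal.tsum_le_tsum fun i => ENNReal.ofReal_le_ofReal ?_
  have hs' : Summable fun i : {i // i ∉ J} => x i := hs.subtype _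
  exact entTerm_mono_right (hx _) (hs'.le_tsum i fun j _ => hx _)
    (hs.tsum_subtype_le _ {i | i ∉ J} hx)

/-- Jensen's inequality for `η` and countable sub-convex combinations of points of `[0, 1]`. -/
theorem tsum_mul_negMulLog_le {q : κ → ℝ} {d : κ → ℝ≥0∞} {p : ℝ} (hq : ∀ v, 0 ≤ q v)
    (hq1 : ∀ v, q v ≤ 1) (hp : 0 ≤ p) (hd : ∑' v, d v ≤ 1)
    (hpq : ENNReal.ofReal p = ∑' v, d v * ENNReal.ofReal (q v)) :
    ∑' v, d v * ENNReal.ofReal (Real.negMulLog (q v)) ≤ ENNReal.ofReal (Real.negMulLog p) := by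
  have hdne : ∑' v, d v ≠ ∞ := ne_top_of_le_ne_top ENNReal.one_ne_top hd
  have hdv : ∀ v, d v ≠ ∞ := ENNReal.ne_top_of_tsum_ne_top hdne
  lift d to κ → ℝ≥0 using hdv
  have hds : Summable d := ENNReal.tsum_coe_ne_top_iff_summable.1 hdne
  have hds' : Summable fun v => (d v : ℝ) := NNReal.summable_coe.2 hds
  have hd1 : ∑' v, (d v : ℝ) ≤ 1 := by
    rw [← ENNReal.coe_tsum hds] at hd
    rw [← NNReal.coe_tsum]
    exact_mod_cast hd
  have key : ∀ f : κ → ℝ, (∀ v, 0 ≤ f v) → Summable (fun v => (d v : ℝ) * f v) →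
      ∑' v, (d v : ℝ≥0∞) * ENNReal.ofReal (f v) = ENNReal.ofReal (∑' v, (d v : ℝ) * f v) := by
    intro f hf hs
    rw [ENNReal.ofReal_tsum_of_nonneg (fun v => mul_nonneg (d v).coe_nonneg (hf v)) hs]
    refine tsum_congr fun v => ?_
    rw [ENNReal.ofReal_mul (d v).coe_nonneg, ENNReal.ofReal_coe_nnreal]
  have hη0 : ∀ v, 0 ≤ Real.negMulLog (q v) := fun v => Real.negMulLog_nonneg (hq v) (hq1 v)
  have hη1 : ∀ v, Real.negMulLog (q v) ≤ 1 := fun v => by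
    have := Real.negMulLog_le_one_sub_self (hq v)
    linarith [hq v]
  have hs1 : Summable fun v => (d v : ℝ) * q v :=
    hds'.of_nonneg_of_le (fun v => mul_nonneg (d v).coe_nonneg (hq v))
      fun v => mul_le_of_le_one_right (d v).coe_nonneg (hq1 v)
  have hs2 : Summable fun v => (d v : ℝ) * Real.negMulLog (q v) :=
    hds'.of_nonneg_of_le (fun v => mul_nonneg (d v).coe_nonneg (hη0 v))
      fun v => mul_le_of_le_one_right (d v).coe_nonneg (hη1 v)
  rw [key _ hq hs1] at hpq
  rw [key _ hη0 hs2]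
  refine ENNReal.ofReal_le_ofReal ?_
  have hpe : p = ∑' v, (d v : ℝ) * q v :=
    (ENNReal.ofReal_eq_ofReal_iff hp (tsum_nonneg fun v => mul_nonneg (d v).coe_nonneg (hq v))).1 hpq
  rcases hp.eq_or_lt with h0 | h0
  · have hz : ∀ v, (d v : ℝ) * q v = 0 := by
      have := (hasSum_zero_iff_of_nonneg fun v => mul_nonneg (d v).coe_nonneg (hq v)).1
        (h0 ▸ hpe ▸ hs1.hasSum)
      exact fun v => congrFun this v
    have hz' : ∀ v, (d v : ℝ) * Real.negMulLog (q v) = 0 := fun v => by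
      rw [Real.negMulLog, ← mul_assoc, mul_neg, hz v]; simp
    simp [hz', ← h0]
  · have ht : ∀ v, Real.negMulLog (q v) ≤ -(q v * Real.log p) + p - q v := fun v => by
      rcases (hq v).eq_or_lt with hv | hv
      · simp [← hv, h0.le]
      · have hl := Real.log_le_sub_one_of_pos (div_pos h0 hv)
        rw [Real.log_div h0.ne' hv.ne'] at hl
        have h2 := mul_le_mul_of_nonneg_left hl hv.le
        have h3 : q v * (p / q v - 1) = p - q v := by field_simp
        rw [h3] at h2
        rw [Real.negMulLog]
        linarith
    have hs3 : Summable fun v => (d v : ℝ) * q v * (-Real.log p - 1) + (d v : ℝ) * p :=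
      (hs1.mul_right _).add (hds'.mul_right _)
    calc ∑' v, (d v : ℝ) * Real.negMulLog (q v)
        ≤ ∑' v, ((d v : ℝ) * q v * (-Real.log p - 1) + (d v : ℝ) * p) := by
          refine hs2.tsum_le_tsum (fun v => ?_) hs3
          have := mul_le_mul_of_nonneg_left (ht v) (d v).coe_nonneg
          linarith
      _ = p * (-Real.log p - 1) + (∑' v, (d v : ℝ)) * p := by
          rw [(hs1.mul_right _).tsum_add (hds'.mul_right _), tsum_mul_right, tsum_mul_right, ← hpe]
      _ ≤ p * (-Real.log p - 1) + 1 * p := by gcongr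
      _ = Real.negMulLog p := by rw [Real.negMulLog]; ring

/-- The entropy does not decrease under mixing by a substochastic matrix whose columns sum to one. -/
theorem clEntropy_le_of_mixing {p : ι → ℝ} {q : κ → ℝ} {d : ι → κ → ℝ≥0∞}
    (hp : ∀ i, 0 ≤ p i) (hq : ∀ v, 0 ≤ q v) (hsq : Summable q)
    (hpq : ∀ i, ENNReal.ofReal (p i) = ∑' v, d i v * ENNReal.ofReal (q v))
    (hrow : ∀ i, ∑' v, d i v ≤ 1) (hcol : ∀ v, q v ≠ 0 → ∑' i, d i v = 1) :
    clEntropy q ≤ clEntropy p := by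
  have hsum : ∀ f : κ → ℝ≥0∞, (∀ v, q v = 0 → f v = 0) →
      ∑' i, ∑' v, d i v * f v = ∑' v, f v := by
    intro f hf
    rw [ENNReal.tsum_comm]
    refine tsum_congr fun v => ?_
    rw [ENNReal.tsum_mul_right]
    by_cases hv : q v = 0
    · simp [hf v hv]
    · rw [hcol v hv, one_mul]
  have htot : ∑' i, ENNReal.ofReal (p i) = ∑' v, ENNReal.ofReal (q v) := by
    simp only [hpq]
    exact hsum _ fun v hv => by simp [hv]
  have hT : ∑' i, p i = ∑' v, q v := by
    have h1 : ∀ i, p i = (ENNReal.ofReal (p i)).toReal := fun i =>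
      (ENNReal.toReal_ofReal (hp i)).symm
    have h2 : ∀ i, q i = (ENNReal.ofReal (q i)).toReal := fun i =>
      (ENNReal.toReal_ofReal (hq i)).symm
    rw [tsum_congr h1, tsum_congr h2, ← ENNReal.tsum_toReal_eq fun _ => ENNReal.ofReal_ne_top,
      ← ENNReal.tsum_toReal_eq fun _ => ENNReal.ofReal_ne_top, htot]
  rw [clEntropy, clEntropy, hT]
  set T := ∑' v, q v
  have hT0 : 0 ≤ T := tsum_nonneg hq
  rcases hT0.eq_or_lt with h0 | h0
  · simp [← h0]
  refine mul_le_mul_right ?_ _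
  rw [← hsum _ fun v hv => by simp [hv]]
  refine ENNReal.tsum_le_tsum fun i => ?_
  refine tsum_mul_negMulLog_le (fun v => div_nonneg (hq v) hT0)
    (fun v => div_le_one_of_le₀ (hsq.le_tsum v fun w _ => hq w) hT0) (div_nonneg (hp i) hT0)
    (hrow i) ?_
  simp only [ENNReal.ofReal_div_of_pos h0, hpq i]
  simp only [div_eq_mul_inv, ← mul_assoc]
  rw [ENNReal.tsum_mul_right]

/-- The entropy of the two-point family `(a, b)`. -/
def binEntropy (a b : ℝ) : ℝ≥0∞ := clEntropy fun c : Bool => cond c a b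

theorem binEntropy_small (M : ℝ) {ε : ℝ≥0∞} (hε : 0 < ε) :
    ∃ δ : ℝ, 0 < δ ∧ ∀ a b : ℝ, 0 ≤ a → a ≤ M → 0 ≤ b → b ≤ δ → binEntropy a b ≤ ε := by
  set f : ℝ → ℝ≥0∞ := fun b => ENNReal.ofReal
    ((Real.negMulLog |M| + Real.negMulLog b) - Real.negMulLog (|M| + b)) with hf
  have hfc : Tendsto f (𝓝 0) (𝓝 0) := by
    have hc : Continuous f := by
      refine ENNReal.continuous_ofReal.comp ?_
      have := Real.continuous_negMulLog
      fun_prop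
    simpa [hf] using hc.tendsto 0
  obtain ⟨δ, hδ, h⟩ := Metric.eventually_nhds_iff.1 (hfc.eventually_le_const hε)
  refine ⟨δ / 2, by positivity, fun a b ha haM hb hbδ => ?_⟩
  have h1 : binEntropy a b ≤ binEntropy |M| b :=
    clEntropy_mono (by rintro (_ | _) <;> simpa) (by
      rintro (_ | _)
      · simp
      · simpa using haM.trans (le_abs_self M)) (Summable.of_finite)
  refine h1.trans ?_
  rw [binEntropy, clEntropy_fintype (by rintro (_ | _) <;> simp [hb])]
  have h2 := h (y := b) (by rw [Real.dist_eq, sub_zero, abs_of_nonneg hb]; linarith)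
  simpa [hf] using h2

end Classical

section Operators

variable {E : Type*} [NormedAddCommGroup E] [InnerProductSpace ℂ E] [CompleteSpace E]
variable {ι : Type*} {A B : E →L[ℂ] E} {s : Set E}

theorem qf_add (A B : E →L[ℂ] E) (v : E) : qf (A + B) v = qf A v + qf B v := by
  simp [qf]

theorem qf_sub (A B : E →L[ℂ] E) (v : E) : qf (A - B) v = qf A v - qf B v := by
  simp [qf]

theorem qf_sum (J : Finset ι) (A : ι → E →L[ℂ] E) (v : E) :
    qf (∑ i ∈ J, A i) v = ∑ i ∈ J, qf (A i) v := by
  simp [qf]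

theorem qf_smul (c : ℝ) (A : E →L[ℂ] E) (v : E) : qf ((c : ℂ) • A) v = c * qf A v := by
  simp [qf]

theorem qf_rankOne (x v : E) : qf (rankOne x) v = ‖inner ℂ x v‖ ^ 2 := by
  simp only [qf, rankOne, ContinuousLinearMap.smulRight_apply, innerSL_apply_apply,
    inner_smul_right]
  rw [← inner_conj_symm v x, Complex.mul_conj, Complex.ofReal_re, Complex.normSq_eq_norm_sq]

theorem qf_nonneg (hA : A.IsPositive) (v : E) : 0 ≤ qf A v := by
  have := hA.inner_nonneg_right v
  rw [Complex.le_def] at this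
  simpa [qf] using this.1

theorem rankOne_isPositive (x : E) : (rankOne x).IsPositive := by
  refine ContinuousLinearMap.isPositive_iff_complex _ |>.2 fun v => ?_
  simp only [rankOne, ContinuousLinearMap.smulRight_apply, innerSL_apply_apply, inner_smul_left]
  rw [inner_conj_symm, ← inner_conj_symm v x, mul_comm, Complex.mul_conj]
  simp [Complex.normSq_nonneg]

/-- The operator `A` is the sum of the rank-one operators `|x i⟩⟨x i|`, in the sense of quadratic
forms. -/
def Resolves (A : E →L[ℂ] E) (x : ι → E) : Prop :=
  ∀ v, HasSum (fun i => ‖inner ℂ (x i) v‖ ^ 2) (qf A v)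

theorem IsONB.hasSum_norm_inner_sq (hs : IsONB s) (x : E) :
    HasSum (fun v : s => ‖inner ℂ (v : E) x‖ ^ 2) (‖x‖ ^ 2) := by
  let b : HilbertBasis s ℂ E := HilbertBasis.mk hs.1 (by
    rw [Subtype.range_coe, (Submodule.dense_iff_topologicalClosure_eq_top).1 hs.2])
  have hb : ∀ v : s, b v = v := fun v => by simp [b]
  have h := b.hasSum_inner_mul_inner x x
  have h2 := Complex.reCLM.hasSum h
  rw [inner_self_eq_norm_sq_to_K] at h2
  convert h2 using 1
  · ext v
    simp only [hb, Complex.reCLM_apply]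
    rw [← inner_conj_symm x (v : E), mul_comm, Complex.mul_conj, Complex.ofReal_re,
      Complex.normSq_eq_norm_sq]
  · simp [← Complex.ofReal_pow]

theorem IsONB.tsum_norm_inner_sq (hs : IsONB s) (x : E) :
    ∑' v : s, ENNReal.ofReal (‖inner ℂ (v : E) x‖ ^ 2) = ENNReal.ofReal (‖x‖ ^ 2) := by
  have h := hs.hasSum_norm_inner_sq x
  rw [← h.tsum_eq, ENNReal.ofReal_tsum_of_nonneg (fun _ => by positivity) h.summable]

theorem Resolves.tsum_norm_inner_sq {x : ι → E} (h : Resolves A x) (v : E) :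
    ∑' i, ENNReal.ofReal (‖inner ℂ (x i) v‖ ^ 2) = ENNReal.ofReal (qf A v) := by
  rw [← (h v).tsum_eq, ENNReal.ofReal_tsum_of_nonneg (fun _ => by positivity) (h v).summable]

theorem Resolves.tsum_qf {x : ι → E} (h : Resolves A x) (hs : IsONB s) :
    ∑' v : s, ENNReal.ofReal (qf A v) = ∑' i, ENNReal.ofReal (‖x i‖ ^ 2) := by
  simp_rw [← h.tsum_norm_inner_sq]
  rw [ENNReal.tsum_comm]
  refine tsum_congr fun i => ?_
  rw [← hs.tsum_norm_inner_sq (x i)]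
  simp_rw [norm_inner_symm]

theorem inner_sqrt (hA : A.IsPositive) (v w : E) :
    inner ℂ (CFC.sqrt A v) (CFC.sqrt A w) = (inner ℂ v (A w) : ℂ) := by
  have h0 : 0 ≤ A := (ContinuousLinearMap.nonneg_iff_isPositive A).2 hA
  have hS := (ContinuousLinearMap.nonneg_iff_isPositive _).1 (CFC.sqrt_nonneg A)
  conv_rhs => rw [← CFC.sqrt_mul_sqrt_self A h0]
  exact hS.isSymmetric _ _

theorem inner_sqrt_left (A : E →L[ℂ] E) (v w : E) :
    inner ℂ (CFC.sqrt A v) w = (inner ℂ v (CFC.sqrt A w) : ℂ) :=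
  ((ContinuousLinearMap.nonneg_iff_isPositive _).1 (CFC.sqrt_nonneg A)).isSymmetric _ _

theorem norm_sqrt_sq (hA : A.IsPositive) (v : E) : ‖CFC.sqrt A v‖ ^ 2 = qf A v := by
  rw [qf, ← inner_sqrt hA, inner_self_eq_norm_sq_to_K]
  simp [← Complex.ofReal_pow]

theorem resolves_sqrt (hA : A.IsPositive) (hs : IsONB s) :
    Resolves A fun v : s => CFC.sqrt A v := by
  intro w
  simp_rw [inner_sqrt_left, ← norm_sqrt_sq hA]
  exact hs.hasSum_norm_inner_sq _

theorem sum_norm_inner_sq_le {n : Type*} [Fintype n] {e : n → E} (he : Orthonormal ℂ e) (x : E) :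
    ∑ i, ENNReal.ofReal (‖inner ℂ x (e i)‖ ^ 2) ≤ ENNReal.ofReal (‖x‖ ^ 2) := by
  rw [← ENNReal.ofReal_sum_of_nonneg fun _ _ => by positivity]
  refine ENNReal.ofReal_le_ofReal ?_
  simpa only [norm_inner_symm] using he.sum_inner_products_le (x := x) (s := Finset.univ)

theorem Resolves.sum_qf_le {n : Type*} [Fintype n] {x : ι → E} (h : Resolves A x) {e : n → E}
    (he : Orthonormal ℂ e) :
    ∑ i, ENNReal.ofReal (qf A (e i)) ≤ ∑' i, ENNReal.ofReal (‖x i‖ ^ 2) := by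
  simp_rw [← h.tsum_norm_inner_sq]
  rw [← Summable.tsum_finsetSum fun _ _ => ENNReal.summable]
  exact ENNReal.tsum_le_tsum fun i => sum_norm_inner_sq_le he (x i)

theorem sum_le_traceNorm {n : Type*} [Fintype n] (A : E →L[ℂ] E) {e f : n → E}
    (he : Orthonormal ℂ e) (hf : Orthonormal ℂ f) :
    ∑ i, ENNReal.ofReal ‖(inner ℂ (e i) (A (f i)) : ℂ)‖ ≤ traceNorm A := by
  let g := (Fintype.equivFin n).symm
  rw [← g.sum_comp]
  refine le_trans ?_ (le_iSup _ (Fintype.card n))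
  refine le_trans ?_ (le_iSup _ (e ∘ g))
  refine le_trans ?_ (le_iSup _ (f ∘ g))
  exact le_trans le_rfl (le_iSup₂_of_le (he.comp _ g.injective) (hf.comp _ g.injective) le_rfl)

theorem traceNorm_le {A : E →L[ℂ] E} {c : ℝ≥0∞}
    (h : ∀ (n : ℕ) (e f : Fin n → E), Orthonormal ℂ e → Orthonormal ℂ f →
      ∑ i, ENNReal.ofReal ‖(inner ℂ (e i) (A (f i)) : ℂ)‖ ≤ c) : traceNorm A ≤ c :=
  iSup_le fun n => iSup_le fun e => iSup_le fun f => iSup₂_le fun he hf => h n e f he hf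

theorem traceNorm_eq_tsum_qf (hA : A.IsPositive) (hs : IsONB s) :
    traceNorm A = ∑' v : s, ENNReal.ofReal (qf A v) := by
  apply le_antisymm
  · refine traceNorm_le fun n e f he hf => ?_
    have hR := resolves_sqrt hA hs
    have h1 := hR.sum_qf_le he
    have h2 := hR.sum_qf_le hf
    rw [← hR.tsum_qf hs] at h1 h2
    have key : ∀ i, ENNReal.ofReal ‖(inner ℂ (e i) (A (f i)) : ℂ)‖ + 
        ENNReal.ofReal ‖(inner ℂ (e i) (A (f i)) : ℂ)‖ ≤
        ENNReal.ofReal (qf A (e i)) + ENNReal.ofReal (qf A (f i)) := by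
      intro i
      rw [← ENNReal.ofReal_add (norm_nonneg _) (norm_nonneg _),
        ← ENNReal.ofReal_add (qf_nonneg hA _) (qf_nonneg hA _)]
      refine ENNReal.ofReal_le_ofReal ?_
      rw [← inner_sqrt hA, ← norm_sqrt_sq hA, ← norm_sqrt_sq hA]
      have := norm_inner_le_norm (𝕜 := ℂ) (CFC.sqrt A (e i)) (CFC.sqrt A (f i))
      nlinarith [sq_nonneg (‖CFC.sqrt A (e i)‖ - ‖CFC.sqrt A (f i)‖)]
    have h3 := (Finset.sum_le_sum fun i (_ : i ∈ Finset.univ) => key i)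
    rw [Finset.sum_add_distrib, Finset.sum_add_distrib] at h3
    have h4 := h3.trans (add_le_add h1 h2)
    rw [← two_mul, ← two_mul] at h4
    exact (ENNReal.mul_le_mul_iff_right (by simp) (by simp)).1 h4
  · rw [ENNReal.tsum_eq_iSup_sum]
    refine iSup_le fun J => ?_
    have ho : Orthonormal ℂ fun v : J => ((v : s) : E) := hs.1.comp _ Subtype.val_injective
    refine le_trans ?_ (sum_le_traceNorm A ho ho)
    rw [← Finset.sum_coe_sort J]
    exact Finset.sum_le_sum fun v _ => ENNReal.ofReal_le_ofReal (Complex.re_le_norm _)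

theorem Resolves.tsum_norm_sq {x : ι → E} (h : Resolves A x) (hA : A.IsPositive) :
    ∑' i, ENNReal.ofReal (‖x i‖ ^ 2) = traceNorm A := by
  obtain ⟨s, hs⟩ := exists_isONB E
  rw [traceNorm_eq_tsum_qf hA hs, h.tsum_qf hs]

theorem traceNorm_add (hA : A.IsPositive) (hB : B.IsPositive) :
    traceNorm (A + B) = traceNorm A + traceNorm B := by
  obtain ⟨s, hs⟩ := exists_isONB E
  rw [traceNorm_eq_tsum_qf hA hs, traceNorm_eq_tsum_qf hB hs,
    traceNorm_eq_tsum_qf (hA.add hB) hs, ← ENNReal.tsum_add]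
  exact tsum_congr fun v => by rw [qf_add, ENNReal.ofReal_add (qf_nonneg hA _) (qf_nonneg hB _)]

theorem traceNorm_add_le (A B : E →L[ℂ] E) : traceNorm (A + B) ≤ traceNorm A + traceNorm B := by
  refine traceNorm_le fun n e f he hf => ?_
  refine le_trans ?_ (add_le_add (sum_le_traceNorm A he hf) (sum_le_traceNorm B he hf))
  rw [← Finset.sum_add_distrib]
  refine Finset.sum_le_sum fun i _ => ?_
  rw [← ENNReal.ofReal_add (norm_nonneg _) (norm_nonneg _)]
  refine ENNReal.ofReal_le_ofReal ?_
  rw [add_apply, inner_add_right]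
  exact norm_add_le _ _

theorem traceNorm_neg (A : E →L[ℂ] E) : traceNorm (-A) = traceNorm A := by
  simp [traceNorm]

theorem traceNorm_sub_comm (A B : E →L[ℂ] E) : traceNorm (A - B) = traceNorm (B - A) := by
  rw [← traceNorm_neg, neg_sub]

theorem traceNorm_zero : traceNorm (0 : E →L[ℂ] E) = 0 := by
  simp [traceNorm]

theorem ofReal_norm_inner_le (A : E →L[ℂ] E) {v w : E} (hv : ‖v‖ = 1) (hw : ‖w‖ = 1) :
    ENNReal.ofReal ‖(inner ℂ v (A w) : ℂ)‖ ≤ traceNorm A := by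
  have h1 : Orthonormal ℂ fun _ : Unit => v := ⟨fun _ => hv, fun i j h => (h rfl).elim⟩
  have h2 : Orthonormal ℂ fun _ : Unit => w := ⟨fun _ => hw, fun i j h => (h rfl).elim⟩
  simpa using sum_le_traceNorm A h1 h2

theorem ofReal_opNorm_le (A : E →L[ℂ] E) : ENNReal.ofReal ‖A‖ ≤ traceNorm A := by
  rcases eq_or_ne (traceNorm A) ∞ with h | h
  · simp [h]
  refine ENNReal.ofReal_le_of_le_toReal ?_
  refine ContinuousLinearMap.opNorm_le_of_unit_norm ENNReal.toReal_nonneg fun w hw => ?_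
  rcases eq_or_ne (A w) 0 with h0 | h0
  · simp [h0]
  have h1 := ofReal_norm_inner_le A (v := ((‖A w‖⁻¹ : ℝ) : ℂ) • A w) (by
    rw [norm_smul]; simp [h0]) hw
  rw [inner_smul_left, inner_self_eq_norm_sq_to_K, ENNReal.ofReal_le_iff_le_toReal h] at h1
  convert h1 using 1
  simp [pow_two, h0]

theorem traceNorm_rankOneM_le (x y : E) :
    traceNorm (rankOneM x y) ≤ ENNReal.ofReal (‖x‖ * ‖y‖) := by
  refine traceNorm_le fun n e f he hf => ?_
  rw [← ENNReal.ofReal_sum_of_nonneg fun _ _ => norm_nonneg _]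
  refine ENNReal.ofReal_le_ofReal ?_
  have h1 := he.sum_inner_products_le (x := x) (s := Finset.univ)
  have h2 := hf.sum_inner_products_le (x := y) (s := Finset.univ)
  have h3 := Finset.sum_mul_sq_le_sq_mul_sq Finset.univ (fun i => ‖inner ℂ (e i) x‖)
    (fun i => ‖inner ℂ (f i) y‖)
  have h4 : ∑ i, ‖inner ℂ (e i) (rankOneM x y (f i))‖ =
      ∑ i, ‖inner ℂ (e i) x‖ * ‖inner ℂ (f i) y‖ := by
    refine Finset.sum_congr rfl fun i _ => ?_
    simp only [rankOneM, ContinuousLinearMap.smulRight_apply, innerSL_apply_apply,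
      inner_smul_right, norm_mul]
    rw [mul_comm, norm_inner_symm y]
  rw [h4]
  refine le_of_sq_le_sq ?_ (by positivity)
  calc _ ≤ _ := h3
    _ ≤ ‖x‖ ^ 2 * ‖y‖ ^ 2 := by gcongr
    _ = _ := by ring

theorem traceNorm_rankOne_sub_le (x y : E) :
    traceNorm (rankOne x - rankOne y) ≤ ENNReal.ofReal (‖x - y‖ * (‖x‖ + ‖y‖)) := by
  have h : rankOne x - rankOne y = rankOneM (x - y) x + rankOneM y (x - y) := by
    ext v
    simp [rankOne, rankOneM, smul_sub, sub_smul]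
  rw [h]
  refine (traceNorm_add_le _ _).trans ((add_le_add (traceNorm_rankOneM_le _ _)
    (traceNorm_rankOneM_le _ _)).trans ?_)
  rw [← ENNReal.ofReal_add (by positivity) (by positivity)]
  exact ENNReal.ofReal_le_ofReal (by nlinarith)

theorem traceNorm_rankOne (x : E) : traceNorm (rankOne x) = ENNReal.ofReal (‖x‖ ^ 2) := by
  have h : Resolves (rankOne x) fun _ : Unit => x := fun v => by
    rw [qf_rankOne]
    exact hasSum_unique _
  rw [← h.tsum_norm_sq (rankOne_isPositive x), tsum_fintype]
  simp

end Operators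

section Spectral

variable {E : Type*} [NormedAddCommGroup E] [InnerProductSpace ℂ E] [CompleteSpace E]
variable {ι κ : Type*} {A B : E →L[ℂ] E} {s : Set E}

theorem isPositive_of_qf_nonneg (hA : A.IsSymmetric) (h : ∀ v, 0 ≤ qf A v) : A.IsPositive := by
  refine ContinuousLinearMap.isPositive_def.2 ⟨hA, fun v => ?_⟩
  have := h v
  rwa [qf, ← hA.apply_clm v v] at this

theorem Resolves.tail {x : ι → E} (h : Resolves A x) (J : Finset ι) :
    Resolves (A - ∑ i ∈ J, rankOne (x i)) fun i : {i // i ∉ J} => x i := by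
  intro v
  rw [qf_sub, qf_sum]
  simp_rw [qf_rankOne]
  refine (Finset.hasSum_compl_iff (f := fun i => ‖inner ℂ (x i) v‖ ^ 2) J).2 ?_
  rw [sub_add_cancel]
  exact h v

theorem isPositive_sum {J : Finset ι} {A : ι → E →L[ℂ] E} (hA : ∀ i ∈ J, (A i).IsPositive) :
    (∑ i ∈ J, A i).IsPositive := by
  simp only [← ContinuousLinearMap.nonneg_iff_isPositive] at hA ⊢
  exact Finset.sum_nonneg hA

theorem Resolves.isPositive_tail {x : ι → E} (h : Resolves A x) (hA : A.IsPositive)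
    (J : Finset ι) : (A - ∑ i ∈ J, rankOne (x i)).IsPositive := by
  refine isPositive_of_qf_nonneg ?_ fun v => (h.tail J v).nonneg fun _ => by positivity
  exact hA.isSymmetric.sub (isPositive_sum fun i _ => rankOne_isPositive (x i)).isSymmetric

theorem Resolves.tendsto_tail {x : ι → E} (h : Resolves A x) (hA : A ∈ posTC E) :
    Tendsto (fun J : Finset ι => traceNorm (A - ∑ i ∈ J, rankOne (x i))) atTop (𝓝 0) := by
  simp_rw [fun J => ((h.tail J).tsum_norm_sq (h.isPositive_tail hA.1 J)).symm]
  refine ENNReal.tendsto_tsum_compl_atTop_zero (f := fun i => ENNReal.ofReal (‖x i‖ ^ 2)) ?_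
  rw [h.tsum_norm_sq hA.1]
  exact hA.2

theorem tendsto_of_traceNorm {l : Filter ι} {A : ι → E →L[ℂ] E} {A₀ : E →L[ℂ] E}
    (h : Tendsto (fun n => traceNorm (A n - A₀)) l (𝓝 0)) : Tendsto A l (𝓝 A₀) := by
  rw [tendsto_iff_norm_sub_tendsto_zero]
  have h1 : Tendsto (fun n => ENNReal.ofReal ‖A n - A₀‖) l (𝓝 0) :=
    tendsto_of_tendsto_of_tendsto_of_le_of_le tendsto_const_nhds h (fun _ => zero_le)
      fun n => ofReal_opNorm_le _
  have h2 := (ENNReal.tendsto_toReal ENNReal.zero_ne_top).comp h1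
  simpa [Function.comp_def, ENNReal.toReal_ofReal (norm_nonneg _)] using h2

theorem isCompactOperator_rankOne (x : E) : IsCompactOperator (rankOne x) := by
  have h : IsCompactOperator (ContinuousLinearMap.toSpanSingleton ℂ x) :=
    isCompactOperator_id.clm_comp (ContinuousLinearMap.toSpanSingleton ℂ x)
  exact h.comp_clm (innerSL ℂ x)

theorem isCompactOperator_of_posTC (hA : A ∈ posTC E) : IsCompactOperator A := by
  obtain ⟨s, hs⟩ := exists_isONB E
  have h := resolves_sqrt hA.1 hs
  have ht := h.tendsto_tail hA
  simp_rw [traceNorm_sub_comm A] at ht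
  refine isCompactOperator_of_tendsto (tendsto_of_traceNorm ht) (Eventually.of_forall fun J => ?_)
  induction J using Finset.induction_on with
  | empty => simpa using isCompactOperator_zero
  | insert i J hi ih =>
    rw [Finset.sum_insert hi]
    exact (isCompactOperator_rankOne _).add ih

theorem exists_eigenbasis (hA : A ∈ posTC E) :
    ∃ s : Set E, IsONB s ∧ ∀ v ∈ s, A v = (qf A v : ℂ) • v := by
  have hsym := hA.1.isSymmetric
  have hbot := ContinuousLinearMap.orthogonalComplement_iSup_eigenspaces_eq_bot
    (isCompactOperator_of_posTC hA) hsym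
  let V : ℂ → Submodule ℂ E := fun μ => Module.End.eigenspace (A : Module.End ℂ E) μ
  have hcl : ∀ μ, IsClosed (V μ : Set E) := fun μ => ContinuousLinearMap.isClosed_eigenspace A μ
  have hcs : ∀ μ, CompleteSpace (V μ) := fun μ => (hcl μ).completeSpace_coe
  choose w hw using fun μ => exists_isONB (V μ)
  have ho := hsym.orthogonalFamily_eigenspaces.orthonormal_sigma_orthonormal
    (v_family := fun μ => ((↑) : w μ → V μ)) fun μ => (hw μ).1
  refine ⟨Set.range fun a : Σ μ, w μ => ((a.2 : V a.1) : E), ⟨ho.toSubtypeRange, ?_⟩, ?_⟩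
  · rw [Submodule.dense_iff_topologicalClosure_eq_top,
      Submodule.topologicalClosure_eq_top_iff, eq_bot_iff]
    intro y hy
    have hy' : ∀ μ, ∀ u : w μ, inner ℂ ((u : V μ) : E) y = 0 := fun μ u =>
      hy _ (Submodule.subset_span ⟨⟨μ, u⟩, rfl⟩)
    rw [← hbot, ← Submodule.iInf_orthogonal]
    refine (Submodule.mem_iInf _).2 fun μ => ?_
    rw [Submodule.mem_orthogonal]
    intro u hu
    have hd : (⟨u, hu⟩ : V μ) ∈ closure ((Submodule.span ℂ (w μ) : Submodule ℂ (V μ)) : Set (V μ)) :=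
      (hw μ).2 _
    have hclosed : IsClosed {u : V μ | inner ℂ (u : E) y = 0} :=
      isClosed_eq (by fun_prop) continuous_const
    refine closure_minimal ?_ hclosed hd
    intro z hz
    induction hz using Submodule.span_induction with
    | mem x h => exact hy' μ ⟨x, h⟩
    | zero => simp
    | add x z _ _ h1 h2 => simp_all
    | smul c x _ h1 => simp_all
  · rintro _ ⟨⟨μ, u⟩, rfl⟩
    have h1 : A ((u : V μ) : E) = μ • ((u : V μ) : E) := 
      Module.End.mem_eigenspace_iff.1 (u : V μ).2
    have h2 : ‖((u : V μ) : E)‖ = 1 := by simpa using (hw μ).1.1 u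
    have h3 : inner ℂ ((u : V μ) : E) (A ((u : V μ) : E)) = μ := by
      rw [h1, inner_smul_right, inner_self_eq_norm_sq_to_K, h2]; simp
    have h4 := hA.1.inner_nonneg_right ((u : V μ) : E)
    rw [h3] at h4
    dsimp only
    rw [qf, h3, h1]
    congr 1
    exact Complex.eq_re_of_ofReal_le (r := 0) (by simpa using h4)

end Spectral

section Entropy

variable {E : Type*} [NormedAddCommGroup E] [InnerProductSpace ℂ E] [CompleteSpace E]
variable {ι κ : Type*} {A B : E →L[ℂ] E} {s : Set E}

theorem posTC_add (hA : A ∈ posTC E) (hB : B ∈ posTC E) : A + B ∈ posTC E :=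
  ⟨hA.1.add hB.1, by
    rw [IsTC, traceNorm_add hA.1 hB.1]
    exact ENNReal.add_ne_top.2 ⟨hA.2, hB.2⟩⟩

theorem rankOne_mem_posTC (x : E) : rankOne x ∈ posTC E :=
  ⟨rankOne_isPositive x, by rw [IsTC, traceNorm_rankOne]; exact ENNReal.ofReal_ne_top⟩

theorem zero_mem_posTC : (0 : E →L[ℂ] E) ∈ posTC E :=
  ⟨ContinuousLinearMap.isPositive_zero, by simp [IsTC, traceNorm_zero]⟩

theorem posTC_sum {J : Finset ι} {A : ι → E →L[ℂ] E} (hA : ∀ i ∈ J, A i ∈ posTC E) :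
    ∑ i ∈ J, A i ∈ posTC E := by
  induction J using Finset.induction_on with
  | empty => simpa using zero_mem_posTC
  | insert i J hi ih =>
    rw [Finset.sum_insert hi]
    exact posTC_add (hA i (by simp)) (ih fun j hj => hA j (by simp [hj]))

theorem hasSum_of_tsum_ofReal {f : ι → ℝ} (hf : ∀ i, 0 ≤ f i) {c : ℝ≥0∞} (hc : c ≠ ∞)
    (h : ∑' i, ENNReal.ofReal (f i) = c) : HasSum f c.toReal := by
  have h1 := ENNReal.hasSum_toReal (h.trans_ne hc)
  simp only [ENNReal.toReal_ofReal (hf _), ← h] at h1 ⊢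
  rw [ENNReal.tsum_toReal_eq (fun _ => ENNReal.ofReal_ne_top)]
  simpa only [ENNReal.toReal_ofReal (hf _)] using h1

theorem Resolves.hasSum_norm_sq {x : ι → E} (h : Resolves A x) (hA : A ∈ posTC E) :
    HasSum (fun i => ‖x i‖ ^ 2) (traceNorm A).toReal :=
  hasSum_of_tsum_ofReal (fun _ => by positivity) hA.2 (h.tsum_norm_sq hA.1)

theorem hasSum_qf (hA : A ∈ posTC E) (hs : IsONB s) :
    HasSum (fun v : s => qf A v) (traceNorm A).toReal :=
  hasSum_of_tsum_ofReal (fun _ => qf_nonneg hA.1 _) hA.2 (traceNorm_eq_tsum_qf hA.1 hs).symm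

theorem qEntropy_add_le (hA : A ∈ posTC E) (hB : B ∈ posTC E) :
    qEntropy A + qEntropy B ≤ qEntropy (A + B) := by
  refine le_iInf₂ fun s hs => ?_
  simp_rw [qf_add]
  refine le_trans ?_ (clEntropy_add_le (fun _ => qf_nonneg hA.1 _) (fun _ => qf_nonneg hB.1 _)
    (hasSum_qf hA hs).summable (hasSum_qf hB hs).summable)
  exact add_le_add (iInf₂_le s hs) (iInf₂_le s hs)

theorem tsum_norm_inner_sq_le {e : ι → E} (he : Orthonormal ℂ e) (x : E) :
    ∑' i, ENNReal.ofReal (‖inner ℂ x (e i)‖ ^ 2) ≤ ENNReal.ofReal (‖x‖ ^ 2) := by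
  rw [ENNReal.tsum_eq_iSup_sum]
  refine iSup_le fun J => ?_
  rw [← Finset.sum_coe_sort J]
  exact sum_norm_inner_sq_le (he.comp _ Subtype.val_injective) x

/-- The squared norms of an orthogonal resolution have the least entropy among all diagonals. -/
theorem Resolves.clEntropy_le_qEntropy {x : ι → E} (h : Resolves A x) (hA : A ∈ posTC E)
    (hx : ∀ i j, i ≠ j → inner ℂ (x i) (x j) = 0) :
    clEntropy (fun i => ‖x i‖ ^ 2) ≤ qEntropy A := by
  refine le_iInf₂ fun s hs => ?_
  refine clEntropy_le_of_mixing
    (d := fun v i => ENNReal.ofReal (‖inner ℂ (v : E) (x i)‖ ^ 2 / ‖x i‖ ^ 2))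
    (fun _ => qf_nonneg hA.1 _) (fun _ => by positivity) (h.hasSum_norm_sq hA).summable ?_ ?_ ?_
  · intro v
    rw [← h.tsum_norm_inner_sq]
    refine tsum_congr fun i => ?_
    rw [← ENNReal.ofReal_mul (by positivity), norm_inner_symm]
    rcases eq_or_ne (x i) 0 with h0 | h0
    · simp [h0]
    · rw [div_mul_cancel₀ _ (by simpa using h0)]
  · intro v
    have ho : Orthonormal ℂ fun i : {i | x i ≠ 0} => ((‖x i‖⁻¹ : ℝ) : ℂ) • x i := by
      refine ⟨fun i => ?_, fun i j hij => ?_⟩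
      · have : ‖x i‖ ≠ 0 := norm_ne_zero_iff.2 i.2
        rw [norm_smul]
        simp [this]
      · dsimp only
        rw [inner_smul_left, inner_smul_right, hx _ _ (fun h => hij (Subtype.ext h))]
        simp
    rw [← tsum_subtype_eq_of_support_subset (s := {i | x i ≠ 0})]
    · have h1 := tsum_norm_inner_sq_le ho (v : E)
      rw [hs.1.1 v] at h1
      simp only [one_pow, ENNReal.ofReal_one] at h1
      refine le_trans (le_of_eq (tsum_congr fun i => ?_)) h1
      rw [inner_smul_right, norm_mul]
      congr 1
      simp
      ring
    · intro i hi h0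
      exact hi (by simp only [h0]; simp)
  · intro i hi
    have h0 : 0 < ‖x i‖ ^ 2 := lt_of_le_of_ne (by positivity) hi.symm
    simp_rw [ENNReal.ofReal_div_of_pos h0, div_eq_mul_inv]
    rw [ENNReal.tsum_mul_right, hs.tsum_norm_inner_sq]
    exact ENNReal.mul_inv_cancel (ENNReal.ofReal_pos.2 h0).ne' ENNReal.ofReal_ne_top

theorem exists_isONB_qEntropy_eq (hA : A ∈ posTC E) :
    ∃ s : Set E, IsONB s ∧ qEntropy A = clEntropy fun v : s => qf A v := by
  obtain ⟨s, hs, he⟩ := exists_eigenbasis hA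
  refine ⟨s, hs, le_antisymm (iInf₂_le s hs) ?_⟩
  have h := (resolves_sqrt hA.1 hs).clEntropy_le_qEntropy hA fun i j hij => by
    rw [inner_sqrt hA.1, he _ j.2, inner_smul_right, hs.1.2 hij, mul_zero]
  simpa only [norm_sqrt_sq hA.1] using h

theorem Resolves.qEntropy_le {x : ι → E} (h : Resolves A x) (hA : A ∈ posTC E) :
    qEntropy A ≤ clEntropy fun i => ‖x i‖ ^ 2 := by
  obtain ⟨s, hs, he⟩ := exists_eigenbasis hA
  refine (iInf₂_le s hs).trans ?_
  have hle : ∀ i v, ‖inner ℂ (x i) v‖ ^ 2 ≤ qf A v := fun i v =>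
    le_hasSum (h v) i fun _ _ => by positivity
  refine clEntropy_le_of_mixing
    (d := fun i v => ENNReal.ofReal (‖inner ℂ (x i) (v : E)‖ ^ 2 / qf A v))
    (fun _ => by positivity) (fun _ => qf_nonneg hA.1 _) (hasSum_qf hA hs).summable ?_ ?_ ?_
  · intro i
    rw [← hs.tsum_norm_inner_sq]
    refine tsum_congr fun v => ?_
    rw [← ENNReal.ofReal_mul (div_nonneg (by positivity) (qf_nonneg hA.1 _)), norm_inner_symm]
    rcases eq_or_ne (qf A v) 0 with h0 | h0
    · have := hle i v
      rw [h0] at this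
      rw [le_antisymm this (by positivity)]
      simp
    · rw [div_mul_cancel₀ _ h0]
  · intro i
    rw [ENNReal.tsum_eq_iSup_sum]
    refine iSup_le fun J => ?_
    rw [← ENNReal.ofReal_sum_of_nonneg fun v _ => div_nonneg (by positivity) (qf_nonneg hA.1 _)]
    refine ENNReal.ofReal_le_one.2 ?_
    set t := ∑ v ∈ J, ‖inner ℂ (x i) (v : E)‖ ^ 2 / qf A v with ht
    let c : s → ℂ := fun v => inner ℂ (v : E) (x i) / qf A v
    have hc : ∀ v : s, inner ℂ (x i) (v : E) * c v =
        ((‖inner ℂ (x i) (v : E)‖ ^ 2 / qf A v : ℝ) : ℂ) := fun v => by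
      simp only [c]
      rw [← mul_div_assoc, ← inner_conj_symm (v : E) (x i), Complex.mul_conj,
        Complex.normSq_eq_norm_sq]
      simp
    have h1 : inner ℂ (x i) (∑ v ∈ J, c v • (v : E)) = (t : ℂ) := by
      rw [inner_sum, ht, Complex.ofReal_sum]
      exact Finset.sum_congr rfl fun v _ => by rw [inner_smul_right, mul_comm, hc]
    have h2 : qf A (∑ v ∈ J, c v • (v : E)) = t := by
      have hAy : A (∑ v ∈ J, c v • (v : E)) = ∑ v ∈ J, (c v * qf A v) • (v : E) := by
        rw [map_sum]
        refine Finset.sum_congr rfl fun v _ => ?_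
        rw [map_smul, he v v.2, smul_smul]
      rw [qf, hAy, hs.1.inner_sum, ht, Complex.re_sum]
      refine Finset.sum_congr rfl fun v _ => ?_
      rcases eq_or_ne (qf A v) 0 with h0 | h0
      · simp [h0, c]
      · have h3 : c v * qf A v = inner ℂ (v : E) (x i) := by
          simp only [c]
          exact div_mul_cancel₀ _ (by exact_mod_cast h0)
        have h4 : (starRingEnd ℂ) (c v) = inner ℂ (x i) (v : E) / qf A v := by
          simp [c]
        rw [h3, h4, ← Complex.ofReal_re (‖inner ℂ (x i) (v : E)‖ ^ 2 / qf A v), ← hc v]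
        simp only [c]
        congr 1
        ring
    have h3 := hle i (∑ v ∈ J, c v • (v : E))
    rw [h1, h2, Complex.norm_real, Real.norm_eq_abs, sq_abs] at h3
    nlinarith
  · intro v hv
    have h0 : 0 < qf A v := lt_of_le_of_ne (qf_nonneg hA.1 _) hv.symm
    simp_rw [ENNReal.ofReal_div_of_pos h0, div_eq_mul_inv]
    rw [ENNReal.tsum_mul_right, h.tsum_norm_inner_sq]
    exact ENNReal.mul_inv_cancel (by simpa using h0) ENNReal.ofReal_ne_top

/-- Countable subadditivity of the entropy up to the entropy of the weights. -/
theorem qEntropy_le_tsum_add {B : ι → E →L[ℂ] E} (hB : ∀ i, B i ∈ posTC E) (hA : A ∈ posTC E)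
    (h : ∀ v, HasSum (fun i => qf (B i) v) (qf A v)) :
    qEntropy A ≤ (∑' i, qEntropy (B i)) + clEntropy fun i => (traceNorm (B i)).toReal := by
  choose s hs he using fun i => exists_isONB_qEntropy_eq (hB i)
  let x : (Σ i, s i) → E := fun p => CFC.sqrt (B p.1) p.2
  have hR : ∀ i, Resolves (B i) fun v : s i => x ⟨i, v⟩ := fun i => resolves_sqrt (hB i).1 (hs i)
  have hx : Resolves A x := by
    intro v
    refine HasSum.sigma_of_hasSum (h v) (fun i => hR i v) ?_
    rw [summable_sigma_of_nonneg fun _ => by positivity]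
    refine ⟨fun i => (hR i v).summable, ?_⟩
    simp_rw [fun i => (hR i v).tsum_eq]
    exact (h v).summable
  refine (hx.qEntropy_le hA).trans ?_
  rw [clEntropy_sigma (fun _ => by positivity) (hx.hasSum_norm_sq hA).summable]
  simp_rw [he, fun i => ((hR i).hasSum_norm_sq (hB i)).tsum_eq]
  simp only [x, norm_sqrt_sq (hB _).1, le_refl]

theorem qEntropy_add_le_add (hA : A ∈ posTC E) (hB : B ∈ posTC E) :
    qEntropy (A + B) ≤ qEntropy A + qEntropy B +
      binEntropy (traceNorm A).toReal (traceNorm B).toReal := by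
  have h := qEntropy_le_tsum_add (B := fun c : Bool => cond c A B) (A := A + B)
    (by rintro (_ | _); exacts [hB, hA]) (posTC_add hA hB) (fun v => by
      rw [qf_add]
      have := hasSum_fintype fun c : Bool => qf (cond c A B) v
      rwa [Fintype.sum_bool] at this)
  rw [tsum_fintype] at h
  simp only [Fintype.sum_bool, cond_true, cond_false] at h
  refine h.trans (le_of_eq ?_)
  rw [binEntropy]
  congr 2
  ext c
  cases c <;> rfl

theorem qEntropy_smul_le (hA : A ∈ posTC E) {c : ℝ} (hc : 0 ≤ c) :
    qEntropy ((c : ℂ) • A) ≤ ENNReal.ofReal c * qEntropy A := by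
  obtain ⟨s, hs, he⟩ := exists_isONB_qEntropy_eq hA
  refine (iInf₂_le s hs).trans (le_of_eq ?_)
  simp_rw [he, qf_smul]
  exact clEntropy_const_mul _ hc

theorem qEntropy_rankOne (x : E) : qEntropy (rankOne x) = 0 := by
  have h : Resolves (rankOne x) fun _ : Unit => x := fun v => by
    rw [qf_rankOne]
    exact hasSum_unique _
  exact le_antisymm ((h.qEntropy_le (rankOne_mem_posTC x)).trans (clEntropy_unique _).le) zero_le

end Entropy

section FiniteRank

variable {E : Type*} [NormedAddCommGroup E] [InnerProductSpace ℂ E] [CompleteSpace E]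
variable {I : Type*} [Fintype I]

/-- The family obtained from `w` by the matrix `V`. -/
def mix (V : Matrix I I ℂ) (w : I → E) (i : I) : E := ∑ j, V j i • w j

theorem resolves_sum_rankOne (w : I → E) : Resolves (∑ j, rankOne (w j)) w := fun v => by
  rw [qf_sum]
  simp_rw [qf_rankOne]
  exact hasSum_fintype _

theorem resolves_mix {V : Matrix I I ℂ} (hV : V ∈ Matrix.unitaryGroup I ℂ) (w : I → E) :
    Resolves (∑ j, rankOne (w j)) (mix V w) := fun v => by
  have h : ∑ j, ‖inner ℂ (mix V w j) v‖ ^ 2 = ∑ j, ‖inner ℂ (w j) v‖ ^ 2 := by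
    have hm : (fun i => inner ℂ (mix V w i) v) =
        Matrix.mulVec V.conjTranspose fun j => inner ℂ (w j) v := by
      ext i
      simp [mix, Matrix.mulVec, dotProduct, mul_comm]
    have hsq : ∀ a : I → ℂ, ((∑ j, ‖a j‖ ^ 2 : ℝ) : ℂ) = dotProduct (star a) a := fun a => by
      simp [dotProduct, ← Complex.normSq_eq_norm_sq, Complex.normSq_eq_conj_mul_self]
    apply Complex.ofReal_injective
    rw [hsq fun j => inner ℂ (mix V w j) v, hsq, hm, Matrix.star_mulVec,
      Matrix.conjTranspose_conjTranspose, ← Matrix.dotProduct_mulVec, Matrix.mulVec_mulVec, ← Matrix.star_eq_conjTranspose,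
      Matrix.mem_unitaryGroup_iff.1 hV, Matrix.one_mulVec]
  rw [qf_sum]
  simp_rw [qf_rankOne]
  rw [← h]
  exact hasSum_fintype _

theorem exists_mix_orthogonal (w : I → E) :
    ∃ V ∈ Matrix.unitaryGroup I ℂ, ∀ i j, i ≠ j → inner ℂ (mix V w i) (mix V w j) = 0 := by
  have hG : (Matrix.gram ℂ w).IsHermitian := Matrix.isHermitian_gram ℂ w
  refine ⟨hG.eigenvectorUnitary, hG.eigenvectorUnitary.2, fun i j hij => ?_⟩
  have h := hG.conjStarAlgAut_star_eigenvectorUnitary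
  rw [Unitary.conjStarAlgAut_star_apply] at h
  have h2 := congrFun (congrFun h i) j
  rw [Matrix.diagonal_apply_ne _ hij] at h2
  rw [← h2, Matrix.mul_apply]
  simp only [mix, inner_sum, sum_inner, inner_smul_left, inner_smul_right, Matrix.mul_apply,
    Matrix.gram_apply, Matrix.star_apply, Finset.sum_mul, Finset.mul_sum]
  refine Finset.sum_congr rfl fun k _ => Finset.sum_congr rfl fun k' _ => ?_
  simp only [RCLike.star_def]
  ring

theorem qEntropy_sum_rankOne (w : I → E) :
    qEntropy (∑ j, rankOne (w j)) = sInf ((fun V : Matrix I I ℂ =>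
      clEntropy fun i => ‖mix V w i‖ ^ 2) '' (Matrix.unitaryGroup I ℂ : Set (Matrix I I ℂ))) := by
  have hW : ∑ j, rankOne (w j) ∈ posTC E := posTC_sum fun j _ => rankOne_mem_posTC (w j)
  apply le_antisymm
  · refine le_sInf ?_
    rintro _ ⟨V, hV, rfl⟩
    exact (resolves_mix hV w).qEntropy_le hW
  · obtain ⟨V, hV, ho⟩ := exists_mix_orthogonal w
    exact (sInf_le (Set.mem_image_of_mem _ hV)).trans ((resolves_mix hV w).clEntropy_le_qEntropy hW ho)

theorem isCompact_unitaryGroup :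
    IsCompact (Matrix.unitaryGroup I ℂ : Set (Matrix I I ℂ)) := by
  have hK : IsCompact (Set.univ.pi fun _ : I => Set.univ.pi fun _ : I =>
      Metric.closedBall (0 : ℂ) 1) :=
    isCompact_univ_pi fun _ => isCompact_univ_pi fun _ => isCompact_closedBall _ _
  have hcl : IsClosed (Matrix.unitaryGroup I ℂ : Set (Matrix I I ℂ)) := isClosed_unitary
  refine hK.of_isClosed_subset hcl fun V hV i _ j _ => ?_
  simpa using entry_norm_bound_of_unitary hV i j

theorem continuous_qEntropy_sum_rankOne :
    Continuous fun w : I → E => qEntropy (∑ j, rankOne (w j)) := by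
  simp_rw [qEntropy_sum_rankOne]
  refine isCompact_unitaryGroup.continuous_sInf
    (f := fun (w : I → E) (V : Matrix I I ℂ) => clEntropy fun i => ‖mix V w i‖ ^ 2) ?_
  simp_rw [fun (w : I → E) (V : Matrix I I ℂ) => clEntropy_fintype
    (x := fun i => ‖mix V w i‖ ^ 2) fun i => by positivity]
  refine ENNReal.continuous_ofReal.comp ?_
  have hm : ∀ i, Continuous fun p : (I → E) × Matrix I I ℂ => ‖mix p.2 p.1 i‖ ^ 2 := fun i => by
    unfold mix
    fun_prop
  exact (continuous_finsetSum _ fun i _ => Real.continuous_negMulLog.comp (hm i)).sub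
    (Real.continuous_negMulLog.comp (continuous_finsetSum _ fun i _ => hm i))

end FiniteRank

section Convergence

variable {E : Type*} [NormedAddCommGroup E] [InnerProductSpace ℂ E] [CompleteSpace E]
variable {α ι : Type*} {l : Filter α} {n₀ : α} {A B : α → E →L[ℂ] E}

/-- Trace-norm convergence along `l` of a family to its own value at `n₀`. -/
def TNConv (l : Filter α) (n₀ : α) (A : α → E →L[ℂ] E) : Prop :=
  Tendsto (fun n => traceNorm (A n - A n₀)) l (𝓝 0)

theorem TNConv.add (hA : TNConv l n₀ A) (hB : TNConv l n₀ B) :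
    TNConv l n₀ fun n => A n + B n := by
  have h := Tendsto.add hA hB
  rw [add_zero] at h
  refine tendsto_of_tendsto_of_tendsto_of_le_of_le tendsto_const_nhds h (fun _ => zero_le)
    fun n => ?_
  dsimp only
  rw [add_sub_add_comm]
  exact traceNorm_add_le _ _

theorem TNConv.sub (hA : TNConv l n₀ A) (hB : TNConv l n₀ B) :
    TNConv l n₀ fun n => A n - B n := by
  have hB' : TNConv l n₀ fun n => -B n := by
    refine Tendsto.congr (fun n => ?_) hB
    rw [← traceNorm_neg, neg_sub, neg_sub_neg]
  simpa only [sub_eq_add_neg] using hA.add hB'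

theorem TNConv.sum {J : Finset ι} {A : ι → α → E →L[ℂ] E} (hA : ∀ i ∈ J, TNConv l n₀ (A i)) :
    TNConv l n₀ fun n => ∑ i ∈ J, A i n := by
  induction J using Finset.induction_on with
  | empty => simpa [TNConv, traceNorm_zero] using tendsto_const_nhds
  | insert i J hi ih =>
    simp_rw [Finset.sum_insert hi]
    exact (hA i (by simp)).add (ih fun j hj => hA j (by simp [hj]))

theorem tnConv_rankOne {w : α → E} (hw : Tendsto w l (𝓝 (w n₀))) :
    TNConv l n₀ fun n => rankOne (w n) := by
  have h : Tendsto (fun n => ENNReal.ofReal (‖w n - w n₀‖ * (‖w n‖ + ‖w n₀‖))) l (𝓝 0) := by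
    have h1 := ((hw.sub_const (w n₀)).norm.mul (hw.norm.add_const ‖w n₀‖))
    simpa using ENNReal.tendsto_ofReal h1
  exact tendsto_of_tendsto_of_tendsto_of_le_of_le tendsto_const_nhds h (fun _ => zero_le)
    fun n => traceNorm_rankOne_sub_le _ _

theorem TNConv.eventually_traceNorm_lt (hA : TNConv l n₀ A) {c : ℝ≥0∞}
    (hc : traceNorm (A n₀) < c) : ∀ᶠ n in l, traceNorm (A n) < c := by
  have h := Tendsto.const_add (traceNorm (A n₀)) hA
  rw [add_zero] at h
  filter_upwards [h.eventually_lt_const hc] with n hn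
  refine lt_of_le_of_lt ?_ hn
  simpa using traceNorm_add_le (A n₀) (A n - A n₀)

/-- Trace-norm convergence of positive trace-class operators together with convergence of their
entropies to a finite limit. -/
structure EntropyConv (l : Filter α) (n₀ : α) (A : α → E →L[ℂ] E) : Prop where
  mem : ∀ n, A n ∈ posTC E
  tnConv : TNConv l n₀ A
  ne_top : qEntropy (A n₀) ≠ ∞
  tendsto : Tendsto (fun n => qEntropy (A n)) l (𝓝 (qEntropy (A n₀)))

theorem tendsto_sqrt (hA : ∀ n, A n ∈ posTC E) (h : TNConv l n₀ A) (v : E) :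
    Tendsto (fun n => CFC.sqrt (A n) v) l (𝓝 (CFC.sqrt (A n₀) v)) := by
  have h0 : ∀ n, 0 ≤ A n := fun n => (ContinuousLinearMap.nonneg_iff_isPositive _).2 (hA n).1
  have h1 : Tendsto A l (𝓝[{a | 0 ≤ a}] (A n₀)) :=
    tendsto_nhdsWithin_iff.2 ⟨tendsto_of_traceNorm h, Eventually.of_forall h0⟩
  have h2 : Tendsto (fun n => CFC.sqrt (A n)) l (𝓝 (CFC.sqrt (A n₀))) :=
    (CFC.continuousOn_sqrt (A n₀) (h0 n₀)).tendsto.comp h1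
  exact ((ContinuousLinearMap.apply ℂ E v).continuous.tendsto _).comp h2

theorem tendsto_qEntropy_sum_rankOne {I : Type*} [Fintype I] {w : α → I → E}
    (hw : ∀ i, Tendsto (fun n => w n i) l (𝓝 (w n₀ i))) :
    Tendsto (fun n => qEntropy (∑ i, rankOne (w n i))) l
      (𝓝 (qEntropy (∑ i, rankOne (w n₀ i)))) :=
  (continuous_qEntropy_sum_rankOne.tendsto (w n₀)).comp (tendsto_pi_nhds.2 hw)

theorem qEntropy_sum_rankOne_ne_top {I : Type*} [Fintype I] (w : I → E) :
    qEntropy (∑ i, rankOne (w i)) ≠ ∞ := by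
  refine ne_top_of_le_ne_top ?_ ((resolves_sum_rankOne w).qEntropy_le
    (posTC_sum fun i _ => rankOne_mem_posTC (w i)))
  rw [clEntropy_fintype fun i => by positivity]
  exact ENNReal.ofReal_ne_top

/-- The tails of an entropy-convergent family are uniformly small. -/
theorem EntropyConv.exists_head_tail (h : EntropyConv l n₀ A) {ε : ℝ≥0∞} (hε : 0 < ε) :
    ∃ (J : Finset E) (w : α → J → E) (Z : α → E →L[ℂ] E),
      (∀ n, A n = (∑ j, rankOne (w n j)) + Z n) ∧ (∀ n, Z n ∈ posTC E) ∧
      (∀ j, Tendsto (fun n => w n j) l (𝓝 (w n₀ j))) ∧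
      ∀ᶠ n in l, qEntropy (Z n) ≤ ε ∧ traceNorm (Z n) ≤ ε := by
  obtain ⟨s, hs, he⟩ := exists_isONB_qEntropy_eq (h.mem n₀)
  set η := ε / 2 / 2 with hη
  have hη0 : 0 < η := by simp [hη, hε.ne']
  obtain ⟨δ, hδ, hbin⟩ := binEntropy_small (traceNorm (A n₀)).toReal hη0
  have hR : ∀ n, Resolves (A n) fun v : s => CFC.sqrt (A n) v :=
    fun n => resolves_sqrt (h.mem n).1 hs
  have hfin : clEntropy (fun v : s => ‖CFC.sqrt (A n₀) v‖ ^ 2) ≠ ∞ := by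
    simpa only [norm_sqrt_sq (h.mem n₀).1, ← he] using h.ne_top
  have hcl := clEntropy_compl_tendsto (fun _ => by positivity)
    ((hR n₀).hasSum_norm_sq (h.mem n₀)).summable hfin
  have htn := (hR n₀).tendsto_tail (h.mem n₀)
  obtain ⟨J, hJ1, hJ2⟩ := ((hcl.eventually_lt_const hη0).and (htn.eventually_lt_const
    (lt_min hε (ENNReal.ofReal_pos.2 hδ)))).exists
  let Hd : α → E →L[ℂ] E := fun n => ∑ v ∈ J, rankOne (CFC.sqrt (A n) v)
  let Z : α → E →L[ℂ] E := fun n => A n - Hd n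
  have hZ : ∀ n, Z n ∈ posTC E := fun n => by
    have hp := (hR n).isPositive_tail (h.mem n).1 J
    have hHd : (Hd n).IsPositive := isPositive_sum fun v _ => rankOne_isPositive _
    refine ⟨hp, ne_top_of_le_ne_top (h.mem n).2 ?_⟩
    have := traceNorm_add hHd hp
    rw [add_sub_cancel] at this
    rw [this]
    exact le_add_self
  have hHdp : ∀ n, Hd n ∈ posTC E := fun n => posTC_sum fun v _ => rankOne_mem_posTC _
  let J' : Finset E := J.map (Function.Embedding.subtype _)
  have hJ' : ∀ n, Hd n = ∑ j : J', rankOne (CFC.sqrt (A n) (j : E)) := fun n => by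
    rw [Finset.sum_coe_sort J' fun v => rankOne (CFC.sqrt (A n) v), Finset.sum_map]
    rfl
  have hw : ∀ v : E, Tendsto (fun n => CFC.sqrt (A n) v) l (𝓝 (CFC.sqrt (A n₀) v)) :=
    tendsto_sqrt h.mem h.tnConv
  have hHdT : Tendsto (fun n => qEntropy (Hd n)) l (𝓝 (qEntropy (Hd n₀))) := by
    simp_rw [hJ']
    exact tendsto_qEntropy_sum_rankOne (w := fun n (j : J') => CFC.sqrt (A n) (j : E))
      fun j => hw j
  have hHdfin : ∀ n, qEntropy (Hd n) ≠ ∞ := fun n => by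
    rw [hJ']
    exact qEntropy_sum_rankOne_ne_top _
  refine ⟨J', fun n j => CFC.sqrt (A n) (j : E), Z, fun n => ?_, hZ, fun j => hw j, ?_⟩
  · rw [← hJ', add_sub_cancel]
  have hZ0 : qEntropy (Z n₀) ≤ η := (((hR n₀).tail J).qEntropy_le (hZ n₀)).trans hJ1.le
  have hb0 : binEntropy (traceNorm (Hd n₀)).toReal (traceNorm (Z n₀)).toReal ≤ η := by
    refine hbin _ _ ENNReal.toReal_nonneg (ENNReal.toReal_mono (h.mem n₀).2 ?_)
      ENNReal.toReal_nonneg (ENNReal.toReal_le_of_le_ofReal hδ.le (hJ2.le.trans (min_le_right _ _)))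
    have := traceNorm_add (hHdp n₀).1 (hZ n₀).1
    rw [add_sub_cancel] at this
    rw [this]
    exact le_self_add
  have hA0 : qEntropy (A n₀) ≤ qEntropy (Hd n₀) + η + η := by
    have := qEntropy_add_le_add (hHdp n₀) (hZ n₀)
    rw [add_sub_cancel] at this
    exact this.trans (by gcongr)
  have hZc : TNConv l n₀ Z := h.tnConv.sub (TNConv.sum fun v _ => tnConv_rankOne (hw v))
  have e1 : ∀ᶠ n in l, qEntropy (A n) < qEntropy (A n₀) + η :=
    h.tendsto.eventually_lt_const (ENNReal.lt_add_right h.ne_top hη0.ne')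
  have e2 : ∀ᶠ n in l, qEntropy (Hd n₀) < qEntropy (Hd n) + η :=
    (hHdT.add_const η).eventually_const_lt (ENNReal.lt_add_right (hHdfin n₀) hη0.ne')
  filter_upwards [e1, e2, hZc.eventually_traceNorm_lt (hJ2.trans_le (min_le_left _ _))]
    with n h1 h2 h3
  refine ⟨?_, h3.le⟩
  have h4 := qEntropy_add_le (hHdp n) (hZ n)
  rw [add_sub_cancel] at h4
  have h5 : qEntropy (Hd n) + qEntropy (Z n) ≤ qEntropy (Hd n) + ε := by
    calc _ ≤ qEntropy (A n₀) + η := h4.trans h1.le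
      _ ≤ qEntropy (Hd n₀) + η + η + η := by gcongr
      _ ≤ qEntropy (Hd n) + η + η + η + η := by gcongr
      _ = qEntropy (Hd n) + ε := by
        rw [add_assoc, add_assoc, add_assoc, ← add_assoc η η (η + η), hη, ENNReal.add_halves,
          ENNReal.add_halves]
  exact (ENNReal.add_le_add_iff_left (hHdfin n)).1 h5

/-- A family approximated, up to uniformly small remainders, by families with convergent
entropies has convergent entropies. -/
theorem EntropyConv.of_approx (hn₀ : pure n₀ ≤ l) (hA : ∀ n, A n ∈ posTC E) (hc : TNConv l n₀ A)
    (h : ∀ ε : ℝ≥0∞, 0 < ε → ∃ Y Z : α → E →L[ℂ] E, (∀ n, A n = Y n + Z n) ∧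
      (∀ n, Y n ∈ posTC E) ∧ (∀ n, Z n ∈ posTC E) ∧ qEntropy (Y n₀) ≠ ∞ ∧
      Tendsto (fun n => qEntropy (Y n)) l (𝓝 (qEntropy (Y n₀))) ∧
      ∀ᶠ n in l, qEntropy (Z n) ≤ ε ∧ traceNorm (Z n) ≤ ε) :
    EntropyConv l n₀ A := by
  have key : ∀ η : ℝ≥0∞, 0 < η → ∃ Y : α → E →L[ℂ] E, qEntropy (Y n₀) ≠ ∞ ∧
      Tendsto (fun n => qEntropy (Y n)) l (𝓝 (qEntropy (Y n₀))) ∧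
      ∀ᶠ n in l, qEntropy (Y n) ≤ qEntropy (A n) ∧ qEntropy (A n) ≤ qEntropy (Y n) + η + η := by
    intro η hη
    obtain ⟨δ, hδ, hbin⟩ := binEntropy_small ((traceNorm (A n₀)).toReal + 1) hη
    obtain ⟨Y, Z, hYZ, hY, hZ, hfin, hYc, hsm⟩ :=
      h (min η (ENNReal.ofReal δ)) (lt_min hη (ENNReal.ofReal_pos.2 hδ))
    have hlt : traceNorm (A n₀) < ENNReal.ofReal ((traceNorm (A n₀)).toReal + 1) := by
      rw [ENNReal.lt_ofReal_iff_toReal_lt (hA n₀).2]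
      exact lt_add_one _
    refine ⟨Y, hfin, hYc, ?_⟩
    filter_upwards [hsm, hc.eventually_traceNorm_lt hlt] with n h1 h2
    have h3 := traceNorm_add (hY n).1 (hZ n).1
    rw [← hYZ] at h3
    have h4 : traceNorm (Y n) ≤ ENNReal.ofReal ((traceNorm (A n₀)).toReal + 1) :=
      le_trans (le_self_add.trans h3.ge) h2.le
    have h5 := hbin (traceNorm (Y n)).toReal (traceNorm (Z n)).toReal ENNReal.toReal_nonneg
      (ENNReal.toReal_le_of_le_ofReal (by positivity) h4) ENNReal.toReal_nonneg
      (ENNReal.toReal_le_of_le_ofReal hδ.le (h1.2.trans (min_le_right _ _)))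
    rw [hYZ n]
    refine ⟨le_self_add.trans (qEntropy_add_le (hY n) (hZ n)),
      (qEntropy_add_le_add (hY n) (hZ n)).trans ?_⟩
    gcongr
    exact h1.1.trans (min_le_left _ _)
  have hne : qEntropy (A n₀) ≠ ∞ := by
    obtain ⟨Y, hfin, -, hev⟩ := key 1 one_pos
    refine ne_top_of_le_ne_top ?_ (hn₀ hev : _ ∧ _).2
    simp [hfin]
  refine ⟨hA, hc, hne, (ENNReal.tendsto_nhds hne).2 fun ε hε => ?_⟩
  set η := ε / 2 / 2 with hη
  have hη0 : 0 < η := by simp [hη, hε.ne']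
  have hηε : η + η + η ≤ ε := by
    calc η + η + η ≤ η + η + (η + η) := by gcongr; exact le_self_add
      _ = ε := by rw [hη, ENNReal.add_halves, ENNReal.add_halves]
  obtain ⟨Y, hfin, hYc, hev⟩ := key η hη0
  have h0 : qEntropy (Y n₀) ≤ qEntropy (A n₀) ∧ qEntropy (A n₀) ≤ qEntropy (Y n₀) + η + η :=
    hn₀ hev
  have e1 := hYc.eventually_lt_const (ENNReal.lt_add_right hfin hη0.ne')
  have e2 := (hYc.add_const η).eventually_const_lt (ENNReal.lt_add_right hfin hη0.ne')
  filter_upwards [hev, e1, e2] with n h1 h2 h3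
  refine ⟨tsub_le_iff_right.2 ?_, ?_⟩
  · calc _ ≤ qEntropy (Y n₀) + η + η := h0.2
      _ ≤ qEntropy (Y n) + η + η + η := by gcongr
      _ ≤ qEntropy (A n) + η + η + η := by gcongr; exact h1.1
      _ = qEntropy (A n) + (η + η + η) := by ring
      _ ≤ _ := by gcongr
  · calc _ ≤ qEntropy (Y n) + η + η := h1.2
      _ ≤ qEntropy (Y n₀) + η + η + η := by gcongr
      _ ≤ qEntropy (A n₀) + η + η + η := by gcongr; exact h0.1
      _ = qEntropy (A n₀) + (η + η + η) := by ring
      _ ≤ _ := by gcongr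

theorem EntropyConv.add (hn₀ : pure n₀ ≤ l) (hA : EntropyConv l n₀ A) (hB : EntropyConv l n₀ B) :
    EntropyConv l n₀ fun n => A n + B n := by
  refine of_approx hn₀ (fun n => posTC_add (hA.mem n) (hB.mem n)) (hA.tnConv.add hB.tnConv)
    fun ε hε => ?_
  set η := ε / 2 / 2 with hη
  have hη0 : 0 < η := by simp [hη, hε.ne']
  have hηε : η + η + η ≤ ε := by
    calc η + η + η ≤ η + η + (η + η) := by gcongr; exact le_self_add
      _ = ε := by rw [hη, ENNReal.add_halves, ENNReal.add_halves]
  obtain ⟨δ, hδ, hbin⟩ := binEntropy_small 1 hη0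
  have hρ : 0 < min η (min 1 (ENNReal.ofReal δ)) :=
    lt_min hη0 (lt_min one_pos (ENNReal.ofReal_pos.2 hδ))
  obtain ⟨J, w, Z, hAZ, hZ, hw, hsm⟩ := hA.exists_head_tail hρ
  obtain ⟨J', w', Z', hBZ, hZ', hw', hsm'⟩ := hB.exists_head_tail hρ
  let u : α → J ⊕ J' → E := fun n => Sum.elim (w n) (w' n)
  refine ⟨fun n => ∑ i, rankOne (u n i), fun n => Z n + Z' n, fun n => ?_,
    fun n => posTC_sum fun i _ => rankOne_mem_posTC _, fun n => posTC_add (hZ n) (hZ' n),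
    qEntropy_sum_rankOne_ne_top _, tendsto_qEntropy_sum_rankOne ?_, ?_⟩
  · dsimp only
    rw [hAZ, hBZ, Fintype.sum_sum_type]
    simp only [u, Sum.elim_inl, Sum.elim_inr]
    abel
  · rintro (j | j)
    exacts [hw j, hw' j]
  filter_upwards [hsm, hsm'] with n h1 h2
  simp only [le_min_iff] at h1 h2
  constructor
  · have h3 := hbin (traceNorm (Z n)).toReal (traceNorm (Z' n)).toReal ENNReal.toReal_nonneg
      (ENNReal.toReal_le_of_le_ofReal zero_le_one (by simpa using h1.2.2.1)) ENNReal.toReal_nonneg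
      (ENNReal.toReal_le_of_le_ofReal hδ.le h2.2.2.2)
    calc _ ≤ _ := qEntropy_add_le_add (hZ n) (hZ' n)
      _ ≤ η + η + η := by gcongr; exacts [h1.1.1, h2.1.1]
      _ ≤ ε := hηε
  · calc _ ≤ _ := traceNorm_add_le _ _
      _ ≤ η + η := add_le_add h1.2.1 h2.2.1
      _ ≤ η + η + η := le_self_add
      _ ≤ ε := hηε

theorem qEntropy_zero : qEntropy (0 : E →L[ℂ] E) = 0 := by
  simpa [rankOne] using qEntropy_rankOne (0 : E)

theorem EntropyConv.sum (hn₀ : pure n₀ ≤ l) {J : Finset ι} {A : ι → α → E →L[ℂ] E}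
    (hA : ∀ i ∈ J, EntropyConv l n₀ (A i)) : EntropyConv l n₀ fun n => ∑ i ∈ J, A i n := by
  induction J using Finset.induction_on with
  | empty =>
    refine ⟨fun _ => by simpa using zero_mem_posTC, TNConv.sum (by simp), ?_, ?_⟩
    · simp [qEntropy_zero]
    · simpa using tendsto_const_nhds
  | insert i J hi ih =>
    simp_rw [Finset.sum_insert hi]
    exact (hA i (by simp)).add hn₀ (ih fun j hj => hA j (by simp [hj]))

theorem ContOn.tendsto {f : (E →L[ℂ] E) → ℝ≥0∞} {𝒜 : Set (E →L[ℂ] E)} (hf : ContOn f 𝒜)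
    (hA : ∀ n, A n ∈ 𝒜) (hc : TNConv l n₀ A) :
    Tendsto (fun n => f (A n)) l (𝓝 (f (A n₀))) := by
  rw [← ENNReal.tendsto_toReal_iff (fun n => hf.1 _ (hA n)) (hf.1 _ (hA n₀)), Metric.tendsto_nhds]
  intro ε hε
  obtain ⟨δ, hδ, h⟩ := hf.2 _ (hA n₀) ε hε
  filter_upwards [hc.eventually_lt_const (ENNReal.ofReal_pos.2 hδ)] with n hn
  exact h _ (hA n) hn

end Convergence

section Maps

variable {E F : Type*}
variable [NormedAddCommGroup E] [InnerProductSpace ℂ E] [CompleteSpace E]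
variable [NormedAddCommGroup F] [InnerProductSpace ℂ F] [CompleteSpace F]
variable {α ι : Type*} {l : Filter α} {n₀ : α} {A B : E →L[ℂ] E} {Φ : TraceMap E F}

theorem TraceMap.map_zero (Φ : TraceMap E F) : Φ.toFun 0 = 0 := by
  have h := Φ.map_smul 0 0 (by simp [IsTC, traceNorm_zero])
  simpa using h

theorem TraceMap.map_sub (Φ : TraceMap E F) (hA : IsTC A) (hB : IsTC B) :
    Φ.toFun (A - B) = Φ.toFun A - Φ.toFun B := by
  have hB' : IsTC (-B) := by rwa [IsTC, traceNorm_neg]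
  have h := Φ.map_smul (-1) B hB
  rw [neg_one_smul, neg_one_smul] at h
  rw [sub_eq_add_neg, Φ.map_add _ _ hA hB', h, ← sub_eq_add_neg]

theorem TraceMap.mem_posTC (Φ : TraceMap E F) (hA : A ∈ posTC E) : Φ.toFun A ∈ posTC F :=
  ⟨Φ.pos A hA.2 hA.1, Φ.maps_tc A hA.2⟩

theorem TraceMap.map_sum (Φ : TraceMap E F) {J : Finset ι} {A : ι → E →L[ℂ] E}
    (hA : ∀ i ∈ J, A i ∈ posTC E) : Φ.toFun (∑ i ∈ J, A i) = ∑ i ∈ J, Φ.toFun (A i) := by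
  induction J using Finset.induction_on with
  | empty => simpa using Φ.map_zero
  | insert i J hi ih =>
    have hJ : ∀ j ∈ J, A j ∈ posTC E := fun j hj => hA j (by simp [hj])
    rw [Finset.sum_insert hi, Finset.sum_insert hi,
      Φ.map_add _ _ (hA i (by simp)).2 (posTC_sum hJ).2, ih hJ]

theorem TraceMap.Bounded.tendsto (hΦ : Φ.Bounded) {A : α → E →L[ℂ] E} (hA : ∀ n, IsTC (A n))
    (hB : IsTC B) (h : Tendsto (fun n => traceNorm (A n - B)) l (𝓝 0)) :
    Tendsto (fun n => traceNorm (Φ.toFun (A n) - Φ.toFun B)) l (𝓝 0) := by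
  obtain ⟨C, hC⟩ := hΦ
  have h1 := ENNReal.Tendsto.const_mul h (Or.inr (ENNReal.coe_ne_top (r := C)))
  rw [mul_zero] at h1
  refine tendsto_of_tendsto_of_tendsto_of_le_of_le tendsto_const_nhds h1 (fun _ => zero_le)
    fun n => ?_
  dsimp only
  rw [← Φ.map_sub (hA n) hB]
  exact hC _

theorem rankOne_apply (x v : E) : rankOne x v = (inner ℂ x v : ℂ) • x := by
  simp [rankOne]

theorem rankOne_smul (c : ℝ) (x : E) : rankOne ((c : ℂ) • x) = ((c ^ 2 : ℝ) : ℂ) • rankOne x := by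
  ext v
  simp only [rankOne_apply, smul_apply, inner_smul_left, Complex.conj_ofReal, smul_smul]
  congr 1
  push_cast
  ring

theorem rankOne_mem_rankCone (x : E) : rankOne x ∈ rankCone E 1 := by
  refine ⟨rankOne_isPositive x, ?_⟩
  rw [rankLE, Nat.cast_one, rank_submodule_le_one_iff']
  refine ⟨x, ?_⟩
  rintro _ ⟨v, rfl⟩
  rw [ContinuousLinearMap.coe_coe, rankOne_apply]
  exact Submodule.smul_mem _ _ (Submodule.mem_span_singleton_self x)

theorem exists_eq_rankOne (hA : A ∈ rankCone E 1) : ∃ x, A = rankOne x := by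
  obtain ⟨hp, hr⟩ := hA
  rw [rankLE, Nat.cast_one, rank_submodule_le_one_iff'] at hr
  obtain ⟨v, hv⟩ := hr
  have hmem : ∀ w, ∃ c : ℂ, c • v = A w := fun w =>
    Submodule.mem_span_singleton.1 (hv ⟨w, rfl⟩)
  rcases eq_or_ne v 0 with rfl | hv0
  · refine ⟨0, ?_⟩
    ext w
    obtain ⟨c, hc⟩ := hmem w
    simp [rankOne_apply, ← hc]
  obtain ⟨a, ha⟩ := hmem v
  have hN : (‖v‖ : ℂ) ≠ 0 := by simpa using hv0
  have hqf : ((qf A v : ℝ) : ℂ) = a * (‖v‖ : ℂ) ^ 2 := by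
    have h1 : ((qf A v : ℝ) : ℂ) = inner ℂ v (A v) := by
      have := hp.inner_nonneg_right v
      rw [Complex.le_def] at this
      exact Complex.ext rfl (by simpa using this.2)
    rw [h1, ← ha, inner_smul_right, inner_self_eq_norm_sq_to_K]
    rfl
  have hconj : (starRingEnd ℂ) a = a := by
    have h2 : a = ((qf A v / ‖v‖ ^ 2 : ℝ) : ℂ) := by
      push_cast
      rw [hqf]
      field_simp
    rw [h2, Complex.conj_ofReal]
  refine ⟨((Real.sqrt (qf A v) / ‖v‖ ^ 2 : ℝ) : ℂ) • v, ?_⟩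
  rw [rankOne_smul, div_pow, Real.sq_sqrt (qf_nonneg hp v)]
  ext w
  obtain ⟨c, hc⟩ := hmem w
  have hcw : c * (‖v‖ : ℂ) ^ 2 = a * inner ℂ v w := by
    have h3 : inner ℂ v (A w) = inner ℂ (A v) w := (hp.isSymmetric v w).symm
    rw [← hc, ← ha, inner_smul_right, inner_smul_left, hconj, inner_self_eq_norm_sq_to_K] at h3
    exact h3
  rw [smul_apply, rankOne_apply, smul_smul, ← hc]
  congr 1
  push_cast
  rw [hqf]
  field_simp
  linear_combination hcw

theorem rankCone_subset_posTC : rankCone E 1 ⊆ posTC E := fun A hA => by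
  obtain ⟨x, rfl⟩ := exists_eq_rankOne hA
  exact rankOne_mem_posTC x

theorem contOn_qEntropy_rankCone : ContOn qEntropy (rankCone E 1) := by
  have h : ∀ A ∈ rankCone E 1, qEntropy A = 0 := fun A hA => by
    obtain ⟨x, rfl⟩ := exists_eq_rankOne hA
    exact qEntropy_rankOne x
  refine ⟨fun A hA => by simp [h A hA], fun A hA ε hε => ⟨1, one_pos, fun B hB _ => ?_⟩⟩
  simpa [h A hA, h B hB] using hε

/-- The output entropy of rank-one operators is bounded on the unit ball. -/
theorem exists_outEntropy_rankOne_le (hΦ : ContOn (outEntropy Φ) (rankCone E 1)) :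
    ∃ c : ℝ, 0 ≤ c ∧ ∀ x : E, qEntropy (Φ.toFun (rankOne x)) ≤ ENNReal.ofReal (c * ‖x‖ ^ 2) := by
  have h0 : (0 : E →L[ℂ] E) ∈ rankCone E 1 := by
    simpa [rankOne] using rankOne_mem_rankCone (0 : E)
  obtain ⟨δ, hδ, h⟩ := hΦ.2 0 h0 1 one_pos
  set r := Real.sqrt (δ / 2) with hr
  have hr0 : 0 < r := Real.sqrt_pos.2 (by positivity)
  have hr2 : r ^ 2 = δ / 2 := Real.sq_sqrt (by positivity)
  have hsmall : ∀ x : E, ‖x‖ ≤ r → qEntropy (Φ.toFun (rankOne x)) ≤ 1 := fun x hx => by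
    have hlt : traceNorm (rankOne x - 0) < ENNReal.ofReal δ := by
      rw [sub_zero, traceNorm_rankOne]
      refine (ENNReal.ofReal_lt_ofReal_iff hδ).2 ?_
      have := pow_le_pow_left₀ (norm_nonneg x) hx 2
      linarith
    have h1 := h _ (rankOne_mem_rankCone x) hlt
    simp only [outEntropy, Φ.map_zero, qEntropy_zero, ENNReal.toReal_zero, sub_zero,
      abs_of_nonneg ENNReal.toReal_nonneg] at h1
    have hfin : qEntropy (Φ.toFun (rankOne x)) ≠ ∞ := hΦ.1 _ (rankOne_mem_rankCone x)
    exact (ENNReal.toReal_le_toReal hfin ENNReal.one_ne_top).1 (by simpa using h1.le)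
  refine ⟨1 / r ^ 2, by positivity, fun x => ?_⟩
  rcases eq_or_ne x 0 with rfl | hx
  · exact (le_of_eq (by simp [rankOne, Φ.map_zero, qEntropy_zero]))
  have hx' : 0 < ‖x‖ := norm_pos_iff.2 hx
  set y : E := ((r / ‖x‖ : ℝ) : ℂ) • x with hy
  have hyn : ‖y‖ ≤ r := by
    rw [hy, norm_smul, Complex.norm_real, Real.norm_of_nonneg (by positivity)]
    exact (by field_simp : r / ‖x‖ * ‖x‖ = r).le
  have hxy : x = ((‖x‖ / r : ℝ) : ℂ) • y := by
    rw [hy, smul_smul, ← Complex.ofReal_mul, (by field_simp : ‖x‖ / r * (r / ‖x‖) = 1)]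
    simp
  have he : rankOne x = (((‖x‖ / r) ^ 2 : ℝ) : ℂ) • rankOne y := by
    rw [← rankOne_smul, ← hxy]
  rw [he, Φ.map_smul _ _ (rankOne_mem_posTC y).2]
  calc _ ≤ ENNReal.ofReal ((‖x‖ / r) ^ 2) * qEntropy (Φ.toFun (rankOne y)) :=
        qEntropy_smul_le (Φ.mem_posTC (rankOne_mem_posTC y)) (by positivity)
    _ ≤ ENNReal.ofReal ((‖x‖ / r) ^ 2) * 1 := by gcongr; exact hsmall y hyn
    _ = _ := by rw [mul_one]; congr 1; ring

theorem continuous_qf (v : E) : Continuous fun A : E →L[ℂ] E => qf A v := by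
  unfold qf
  fun_prop

/-- The output entropy is dominated by the trace and the input entropy. -/
theorem exists_outEntropy_le (hb : Φ.Bounded) (hΦ : ContOn (outEntropy Φ) (rankCone E 1)) :
    ∃ c M : ℝ≥0, ∀ A ∈ posTC E, qEntropy (Φ.toFun A) ≤ c * traceNorm A + M * qEntropy A := by
  obtain ⟨c, hc0, hc⟩ := exists_outEntropy_rankOne_le hΦ
  obtain ⟨C, hC⟩ := id hb
  refine ⟨c.toNNReal, C, fun A hA => ?_⟩
  obtain ⟨s, hs, he⟩ := exists_isONB_qEntropy_eq hA
  have hR := resolves_sqrt hA.1 hs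
  have hmem : ∀ v : s, rankOne (CFC.sqrt A (v : E)) ∈ posTC E := fun v => rankOne_mem_posTC _
  have hsum : ∀ w : F, HasSum (fun v : s => qf (Φ.toFun (rankOne (CFC.sqrt A (v : E)))) w)
      (qf (Φ.toFun A) w) := fun w => by
    have h1 : Tendsto (fun J : Finset s => traceNorm ((∑ v ∈ J, rankOne (CFC.sqrt A (v : E))) - A))
        atTop (𝓝 0) := by
      simpa only [traceNorm_sub_comm] using hR.tendsto_tail hA
    have h2 := tendsto_of_traceNorm (hb.tendsto (fun J => (posTC_sum fun v _ => hmem v).2) hA.2 h1)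
    have h3 := ((continuous_qf w).tendsto _).comp h2
    refine Tendsto.congr (fun J => ?_) h3
    simp only [Function.comp_apply]
    rw [Φ.map_sum fun v _ => hmem v, qf_sum]
  refine (qEntropy_le_tsum_add (fun v => Φ.mem_posTC (hmem v)) (Φ.mem_posTC hA) hsum).trans ?_
  have hsq : ∀ v : s, ‖CFC.sqrt A (v : E)‖ ^ 2 = qf A v := fun v => norm_sqrt_sq hA.1 v
  gcongr
  · calc _ ≤ ∑' v : s, ENNReal.ofReal c * ENNReal.ofReal (qf A v) :=
          ENNReal.tsum_le_tsum fun v => by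
            rw [← ENNReal.ofReal_mul hc0, ← hsq]
            exact hc _
      _ = _ := by
        rw [ENNReal.tsum_mul_left, ← traceNorm_eq_tsum_qf hA.1 hs]
        rfl
  · rw [he]
    calc _ ≤ clEntropy fun v : s => (C : ℝ) * qf A v := by
          refine clEntropy_mono (fun _ => ENNReal.toReal_nonneg) (fun v => ?_)
            ((hasSum_qf hA hs).summable.mul_left _)
          have h1 := hC (rankOne (CFC.sqrt A (v : E)))
          rw [traceNorm_rankOne, hsq, ← ENNReal.ofReal_coe_nnreal, ← ENNReal.ofReal_mul C.coe_nonneg] at h1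
          exact ENNReal.toReal_le_of_le_ofReal (mul_nonneg C.coe_nonneg (qf_nonneg hA.1 _)) h1
      _ = _ := by rw [clEntropy_const_mul _ C.coe_nonneg, ENNReal.ofReal_coe_nnreal]

/-- A bounded map with output entropy continuous on rank-one operators preserves entropic
convergence. -/
theorem EntropyConv.map {A : α → E →L[ℂ] E} (hn₀ : pure n₀ ≤ l) (hA : EntropyConv l n₀ A)
    (hb : Φ.Bounded) (hΦ : ContOn (outEntropy Φ) (rankCone E 1)) :
    EntropyConv l n₀ fun n => Φ.toFun (A n) := by
  refine of_approx hn₀ (fun n => Φ.mem_posTC (hA.mem n))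
    (hb.tendsto (fun n => (hA.mem n).2) (hA.mem n₀).2 hA.tnConv) fun ε hε => ?_
  obtain ⟨c, M, hcM⟩ := exists_outEntropy_le hb hΦ
  obtain ⟨C, hC⟩ := id hb
  obtain ⟨ρ, hρ, hρε⟩ : ∃ ρ : ℝ≥0∞, 0 < ρ ∧ ((c + M + C : ℝ≥0) : ℝ≥0∞) * ρ ≤ ε := by
    refine ⟨ε / ((c + M + C : ℝ≥0) : ℝ≥0∞), ENNReal.div_pos hε.ne' ENNReal.coe_ne_top,
      ENNReal.mul_div_le⟩
  obtain ⟨J, w, Z, hAZ, hZ, hw, hsm⟩ := hA.exists_head_tail hρ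
  have hY : EntropyConv l n₀ fun n => ∑ j, Φ.toFun (rankOne (w n j)) := by
    refine EntropyConv.sum (A := fun j n => Φ.toFun (rankOne (w n j))) hn₀ fun j _ => ?_
    have hc := tnConv_rankOne (hw j)
    exact ⟨fun n => Φ.mem_posTC (rankOne_mem_posTC _),
      hb.tendsto (fun n => (rankOne_mem_posTC _).2) (rankOne_mem_posTC _).2 hc,
      hΦ.1 _ (rankOne_mem_rankCone _), hΦ.tendsto (fun n => rankOne_mem_rankCone _) hc⟩
  refine ⟨_, fun n => Φ.toFun (Z n), fun n => ?_, hY.mem, fun n => Φ.mem_posTC (hZ n), hY.ne_top,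
    hY.tendsto, ?_⟩
  · dsimp only
    rw [hAZ, Φ.map_add _ _ (posTC_sum fun j _ => rankOne_mem_posTC _).2 (hZ n).2,
      Φ.map_sum fun j _ => rankOne_mem_posTC _]
  filter_upwards [hsm] with n hn
  push_cast at hρε
  constructor
  · calc _ ≤ _ := hcM _ (hZ n)
      _ ≤ c * ρ + M * ρ := by gcongr; exacts [hn.2, hn.1]
      _ ≤ (c + M + C) * ρ := by rw [add_mul, add_mul]; exact le_self_add
      _ ≤ ε := hρε
  · calc _ ≤ _ := hC _
      _ ≤ C * ρ := by gcongr; exact hn.2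
      _ ≤ (c + M + C) * ρ := by rw [add_mul]; exact le_add_self
      _ ≤ ε := hρε

/-- Continuity on a set in terms of the trace-norm neighbourhoods of its points. -/
theorem contOn_of_tendsto {f : (E →L[ℂ] E) → ℝ≥0∞} {𝒜 : Set (E →L[ℂ] E)}
    (hfin : ∀ A ∈ 𝒜, f A ≠ ∞)
    (h : ∀ A ∈ 𝒜, Tendsto (fun B : 𝒜 => f B)
      (comap (fun B : 𝒜 => traceNorm ((B : E →L[ℂ] E) - A)) (𝓝 0)) (𝓝 (f A))) :
    ContOn f 𝒜 := by
  refine ⟨hfin, fun A hA ε hε => ?_⟩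
  have h1 := (ENNReal.tendsto_toReal_iff (fun B : 𝒜 => hfin _ B.2) (hfin A hA)).2 (h A hA)
  have h2 := (Metric.tendsto_nhds.1 h1 ε hε)
  obtain ⟨δ, hδ, hsub⟩ := ((ENNReal.nhds_zero_basis.comap _).mem_iff).1 h2
  have hδ' : 0 < min δ 1 := lt_min hδ one_pos
  have hfinδ : min δ 1 ≠ ∞ := ne_top_of_le_ne_top ENNReal.one_ne_top (min_le_right _ _)
  refine ⟨(min δ 1).toReal, ENNReal.toReal_pos hδ'.ne' hfinδ, fun B hB hlt => ?_⟩
  rw [ENNReal.ofReal_toReal hfinδ] at hlt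
  exact hsub (a := ⟨B, hB⟩) (hlt.trans_le (min_le_left _ _))

end Maps

theorem pce_comp {E F G : Type*}
    [NormedAddCommGroup E] [InnerProductSpace ℂ E] [CompleteSpace E]
    [NormedAddCommGroup F] [InnerProductSpace ℂ F] [CompleteSpace F]
    [NormedAddCommGroup G] [InnerProductSpace ℂ G] [CompleteSpace G]
    {Φ : TraceMap E F} {Ψ : TraceMap F G} (hΦb : Φ.Bounded) (hΨb : Ψ.Bounded)
    (hΦ : ContOn (outEntropy Φ) (rankCone E 1)) (hΨ : ContOn (outEntropy Ψ) (rankCone F 1)) :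
    PCE fun A => Ψ.toFun (Φ.toFun A) := by
  intro 𝒜 h𝒜 hc
  have key : ∀ A (hA : A ∈ 𝒜), EntropyConv
      (comap (fun B : 𝒜 => traceNorm ((B : E →L[ℂ] E) - A)) (𝓝 0)) ⟨A, hA⟩
      fun B : 𝒜 => Ψ.toFun (Φ.toFun B) := fun A hA => by
    have hn₀ : pure (⟨A, hA⟩ : 𝒜) ≤
        comap (fun B : 𝒜 => traceNorm ((B : E →L[ℂ] E) - A)) (𝓝 0) := by
      rw [← tendsto_iff_comap, tendsto_pure_left]
      intro s hs
      simpa [traceNorm_zero] using mem_of_mem_nhds hs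
    have hT : TNConv (comap (fun B : 𝒜 => traceNorm ((B : E →L[ℂ] E) - A)) (𝓝 0)) ⟨A, hA⟩
      (fun B : 𝒜 => (B : E →L[ℂ] E)) := tendsto_comap
    have h0 : EntropyConv (comap (fun B : 𝒜 => traceNorm ((B : E →L[ℂ] E) - A)) (𝓝 0)) ⟨A, hA⟩
        (fun B : 𝒜 => (B : E →L[ℂ] E)) :=
      ⟨fun B => h𝒜 B.2, hT, hc.1 A hA, hc.tendsto (fun B => B.2) hT⟩
    exact (h0.map hn₀ hΦb hΦ).map hn₀ hΨb hΨ
  exact contOn_of_tendsto (fun A hA => (key A hA).ne_top) fun A hA => (key A hA).tendsto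

/-- Corollary 6 of the paper. If positive linear bounded maps
`Φ : 𝔗(ℋ) → 𝔗(ℋ')` and `Ψ : 𝔗(ℋ') → 𝔗(ℋ'')` each have output entropy continuous on
the set of positive operators of rank ≤ 1, then so does the composition `Ψ∘Φ`; in
particular, the composition of two PCE-maps is a PCE-map. -/
theorem statement11
    {E F G : Type*}
    [NormedAddCommGroup E] [InnerProductSpace ℂ E] [CompleteSpace E]
    [TopologicalSpace.SeparableSpace E]
    [NormedAddCommGroup F] [InnerProductSpace ℂ F] [CompleteSpace F]
    [TopologicalSpace.SeparableSpace F]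
    [NormedAddCommGroup G] [InnerProductSpace ℂ G] [CompleteSpace G]
    [TopologicalSpace.SeparableSpace G]
    (Φ : TraceMap E F) (Ψ : TraceMap F G) (hΦb : Φ.Bounded) (hΨb : Ψ.Bounded)
    (hΦ : ContOn (outEntropy Φ) (rankCone E 1))
    (hΨ : ContOn (outEntropy Ψ) (rankCone F 1)) :
    ContOn (fun A => qEntropy (Ψ.toFun (Φ.toFun A))) (rankCone E 1) ∧
      PCE (fun A => Ψ.toFun (Φ.toFun A)) := by
  have h := pce_comp hΦb hΨb hΦ hΨ
  exact ⟨h _ rankCone_subset_posTC contOn_qEntropy_rankCone, h⟩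

end QIT
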